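/- arXiv:1302.3738 — 6 statements merged into one kernel-verified Lean document; each statement's English description precedes it below -/
import Mathlib

section
/- Let α > 0. The function v_α is continuous on ℝ and real-analytic on ℝ∖{-c_α}; moreover for x ∈ (-c_α, ∞) its derivative is v_α′(x) = −(∫₀^∞ (x−t) t e^{-t}/((x−t)² + v_α(x)²)² dt) / (v_α(x) ∫₀^∞ t e^{-t}/((x−t)² + v_α(x)²)² dt). -/
open MeasureTheory Set Filter

/-- `F(x+iy) = ∫₀^∞ t e^{-t}/((x-t)² + y²) dt`. -/
noncomputable def Fint (x y : ℝ) : ℝ :=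
  ∫ t in Set.Ioi (0:ℝ), t * Real.exp (-t) / ((x - t)^2 + y^2)

/-- `H_α(z) = z + α + α ∫₀^∞ t e^{-t}/(z-t) dt`. -/
noncomputable def Hfun (α : ℝ) (z : ℂ) : ℂ :=
  z + (α : ℂ) + (α : ℂ) * ∫ t in Set.Ioi (0:ℝ), ((t * Real.exp (-t) : ℝ) : ℂ) / (z - (t : ℂ))

open scoped Topology ContDiff

lemma aux_int_w : Integrable (fun t : ℝ => t * Real.exp (-t)) (volume.restrict (Ioi 0)) := by
  have h := Real.GammaIntegral_convergent (s := 2) (by norm_num)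
  refine (h.congr_fun (fun t ht => ?_) measurableSet_Ioi)
  norm_num
  ring

lemma aux_int_bdd {E : Type*} [NormedAddCommGroup E] (g : ℝ → E) (C : ℝ)
    (hm : AEStronglyMeasurable g (volume.restrict (Ioi 0)))
    (hb : ∀ t : ℝ, 0 < t → ‖g t‖ ≤ C * (t * Real.exp (-t))) :
    Integrable g (volume.restrict (Ioi 0)) := by
  refine (aux_int_w.const_mul C).mono' hm ?_
  filter_upwards [ae_restrict_mem measurableSet_Ioi] with t ht using hb t ht

lemma aux_pos (g : ℝ → ℝ) (hg : Integrable g (volume.restrict (Ioi 0)))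
    (hp : ∀ t : ℝ, 0 < t → 0 < g t) : 0 < ∫ t in Ioi (0:ℝ), g t := by
  rw [setIntegral_pos_iff_support_of_nonneg_ae _ hg]
  · have : Function.support g ∩ Ioi 0 = Ioi 0 := by
      apply inter_eq_right.2
      intro t ht
      exact (hp t ht).ne'
    rw [this]
    simp
  · filter_upwards [ae_restrict_mem measurableSet_Ioi] with t ht using (hp t ht).le

lemma aux_intF (x y : ℝ) (hy : 0 < y) :
    Integrable (fun t : ℝ => t * Real.exp (-t) / ((x - t)^2 + y^2)) (volume.restrict (Ioi 0)) := by
  refine aux_int_bdd _ (1 / y^2) (Measurable.aestronglyMeasurable (by fun_prop)) fun t ht => ?_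
  have hw : 0 < t * Real.exp (-t) := by positivity
  rw [Real.norm_of_nonneg (by positivity), div_eq_mul_one_div, mul_comm]
  gcongr
  nlinarith [sq_nonneg (x - t)]

lemma aux_intD (x y : ℝ) (hy : 0 < y) :
    Integrable (fun t : ℝ => t * Real.exp (-t) / ((x - t)^2 + y^2)^2)
      (volume.restrict (Ioi 0)) := by
  refine aux_int_bdd _ (1 / (y^2)^2) (Measurable.aestronglyMeasurable (by fun_prop)) fun t ht => ?_
  have hw : 0 < t * Real.exp (-t) := by positivity
  rw [Real.norm_of_nonneg (by positivity), div_eq_mul_one_div, mul_comm]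
  gcongr
  nlinarith [sq_nonneg (x - t)]

lemma aux_Fx (x y : ℝ) (hy : 0 < y) : HasDerivAt (fun x => Fint x y)
    (-2 * ∫ t in Ioi (0:ℝ), (x - t) * (t * Real.exp (-t)) / ((x - t)^2 + y^2)^2) x := by
  rw [← integral_const_mul]
  refine (hasDerivAt_integral_of_dominated_loc_of_deriv_le (s := univ)
    (bound := fun t => (1 / y^3) * (t * Real.exp (-t)))
    (F' := fun x t => -2 * ((x - t) * (t * Real.exp (-t)) / ((x - t)^2 + y^2)^2))
    univ_mem ?_ (aux_intF x y hy) ?_ ?_ (aux_int_w.const_mul _) ?_).2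
  · exact Eventually.of_forall fun x => Measurable.aestronglyMeasurable (by fun_prop)
  · exact Measurable.aestronglyMeasurable (by fun_prop)
  · filter_upwards [ae_restrict_mem measurableSet_Ioi] with t ht x _
    have ht : 0 < t := ht
    have hw : 0 < t * Real.exp (-t) := by positivity
    have hq : 0 < (x - t)^2 + y^2 := by positivity
    rw [show -2 * ((x - t) * (t * Real.exp (-t)) / ((x - t)^2 + y^2)^2) =
      ((-2 * (x - t)) / ((x - t)^2 + y^2)^2) * (t * Real.exp (-t)) by ring, norm_mul,
      Real.norm_of_nonneg hw.le, norm_div, Real.norm_of_nonneg (r := ((x - t)^2 + y^2)^2)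
        (by positivity)]
    refine mul_le_mul_of_nonneg_right ?_ hw.le
    rw [div_le_div_iff₀ (by positivity) (by positivity), Real.norm_eq_abs]
    have h1 : |-2 * (x - t)| * y ≤ (x - t)^2 + y^2 := by
      rw [abs_mul, ← sq_abs (x - t)]
      norm_num
      nlinarith [sq_nonneg (|x - t| - y), sq_abs (x - t)]
    have h2 : y^2 ≤ (x - t)^2 + y^2 := by nlinarith [sq_nonneg (x - t)]
    calc |-2 * (x - t)| * y^3 = (|-2 * (x - t)| * y) * y^2 := by ring
      _ ≤ ((x - t)^2 + y^2) * ((x - t)^2 + y^2) := by gcongr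
      _ = _ := by ring
  · filter_upwards with t x _
    have hq : (x - t)^2 + y^2 ≠ 0 := by positivity
    have h := ((((hasDerivAt_id x).sub_const t).pow 2).add_const (y^2))
    have h2 := (hasDerivAt_const x (t * Real.exp (-t))).div h hq
    refine HasDerivAt.congr_deriv h2 ?_
    simp
    ring

lemma aux_Fy (x y : ℝ) (hy : 0 < y) : HasDerivAt (fun y => Fint x y)
    (-2 * y * ∫ t in Ioi (0:ℝ), (t * Real.exp (-t)) / ((x - t)^2 + y^2)^2) y := by
  rw [← integral_const_mul]
  refine (hasDerivAt_integral_of_dominated_loc_of_deriv_le (s := Ioi (y/2))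
    (bound := fun t => (2 / (y/2)^3) * (t * Real.exp (-t)))
    (F' := fun y t => -2 * y * ((t * Real.exp (-t)) / ((x - t)^2 + y^2)^2))
    (Ioi_mem_nhds (by linarith)) ?_ (aux_intF x y hy) ?_ ?_ (aux_int_w.const_mul _) ?_).2
  · exact Eventually.of_forall fun x => Measurable.aestronglyMeasurable (by fun_prop)
  · exact Measurable.aestronglyMeasurable (by fun_prop)
  · filter_upwards [ae_restrict_mem measurableSet_Ioi] with t ht u hu
    have ht : 0 < t := ht
    have hu : y/2 < u := hu
    have hu0 : 0 < u := by linarith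
    have hw : 0 < t * Real.exp (-t) := by positivity
    have hq : 0 < (x - t)^2 + u^2 := by positivity
    rw [show -2 * u * ((t * Real.exp (-t)) / ((x - t)^2 + u^2)^2) =
      -((2 * u / ((x - t)^2 + u^2)^2) * (t * Real.exp (-t))) by ring, norm_neg,
      Real.norm_of_nonneg (by positivity)]
    refine mul_le_mul_of_nonneg_right ?_ hw.le
    have h2 : u^2 ≤ (x - t)^2 + u^2 := by nlinarith [sq_nonneg (x - t)]
    calc 2 * u / ((x - t)^2 + u^2)^2 ≤ 2 * u / (u^2)^2 := by gcongr
      _ = 2 / u^3 := by field_simp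
      _ ≤ _ := by gcongr
  · filter_upwards with t u hu
    have hu : y/2 < u := hu
    have hu0 : 0 < u := by linarith
    have hq : (x - t)^2 + u^2 ≠ 0 := by positivity
    have h := (((hasDerivAt_id u).pow 2).const_add ((x - t)^2))
    have h2 := (hasDerivAt_const u (t * Real.exp (-t))).div h hq
    refine HasDerivAt.congr_deriv h2 ?_
    simp
    ring

/-- The Cauchy transform. -/
noncomputable def auxG (z : ℂ) : ℂ :=
  ∫ t in Ioi (0:ℝ), ((t * Real.exp (-t) : ℝ) : ℂ) / (z - (t : ℂ))

lemma aux_norm (z : ℂ) (t : ℝ) : |z.im| ≤ ‖z - (t : ℂ)‖ := by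
  have := Complex.abs_im_le_norm (z - (t : ℂ))
  simpa using this

lemma aux_intG (z : ℂ) (hz : 0 < z.im) :
    Integrable (fun t : ℝ => ((t * Real.exp (-t) : ℝ) : ℂ) / (z - (t : ℂ)))
      (volume.restrict (Ioi 0)) := by
  have hm : Measurable (fun t : ℝ => ((t * Real.exp (-t) : ℝ) : ℂ) / (z - (t : ℂ))) := by fun_prop
  refine aux_int_bdd _ (1 / z.im) hm.aestronglyMeasurable fun t ht => ?_
  have hw : 0 < t * Real.exp (-t) := by positivity
  rw [norm_div, Complex.norm_real, Real.norm_of_nonneg hw.le, div_eq_mul_one_div, mul_comm]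
  have := aux_norm z t
  rw [abs_of_pos hz] at this
  gcongr

lemma aux_G_diff (z : ℂ) (hz : 0 < z.im) : DifferentiableAt ℂ auxG z := by
  have hs : {w : ℂ | z.im / 2 < w.im} ∈ 𝓝 z :=
    (isOpen_lt continuous_const Complex.continuous_im).mem_nhds (by simp; linarith)
  refine (hasDerivAt_integral_of_dominated_loc_of_deriv_le (s := {w : ℂ | z.im / 2 < w.im})
    (bound := fun t => (1 / (z.im/2)^2) * (t * Real.exp (-t)))
    (F' := fun z t => -(((t * Real.exp (-t) : ℝ) : ℂ) / (z - (t : ℂ))^2))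
    hs ?_ (aux_intG z hz) ?_ ?_ (aux_int_w.const_mul _) ?_).2.differentiableAt
  · refine Eventually.of_forall fun z => ?_
    have hm : Measurable (fun t : ℝ => ((t * Real.exp (-t) : ℝ) : ℂ) / (z - (t : ℂ))) := by
      fun_prop
    exact hm.aestronglyMeasurable
  · have hm : Measurable (fun t : ℝ => -(((t * Real.exp (-t) : ℝ) : ℂ) / (z - (t : ℂ))^2)) := by
      fun_prop
    exact hm.aestronglyMeasurable
  · filter_upwards [ae_restrict_mem measurableSet_Ioi] with t ht u hu
    have ht : 0 < t := ht
    have hu : z.im/2 < u.im := hu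
    have hw : 0 < t * Real.exp (-t) := by positivity
    rw [norm_neg, norm_div, Complex.norm_real, Real.norm_of_nonneg hw.le, div_eq_mul_one_div,
      mul_comm, norm_pow]
    have := aux_norm u t
    rw [abs_of_pos (by linarith)] at this
    have h3 : z.im / 2 ≤ ‖u - (t : ℂ)‖ := by linarith
    gcongr
  · filter_upwards with t u hu
    have hu : z.im/2 < u.im := hu
    have hq : u - (t : ℂ) ≠ 0 := by
      intro h
      have := aux_norm u t
      rw [h, norm_zero, abs_of_pos (by linarith)] at this
      linarith
    have h := (hasDerivAt_id u).sub_const (t : ℂ)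
    have h2 := (hasDerivAt_const u ((t * Real.exp (-t) : ℝ) : ℂ)).div h hq
    refine HasDerivAt.congr_deriv h2 ?_
    simp
    ring

lemma aux_FG (x y : ℝ) (hy : 0 < y) : Fint x y = -(auxG (x + y * Complex.I)).im / y := by
  have hz : 0 < ((x : ℂ) + y * Complex.I).im := by simpa using hy
  have h : (auxG (x + y * Complex.I)).im =
      ∫ t in Ioi (0:ℝ), (((t * Real.exp (-t) : ℝ) : ℂ) / ((x + y * Complex.I) - (t : ℂ))).im :=
    (integral_im (aux_intG _ hz)).symm
  have h2 : (auxG (x + y * Complex.I)).im = -y * Fint x y := by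
    rw [h, Fint, ← integral_const_mul]
    congr 1
    ext t
    rw [div_eq_mul_inv, Complex.im_ofReal_mul, Complex.inv_im, Complex.normSq_apply]
    simp
    ring
  rw [h2]
  field_simp

lemma aux_F_cd (x y : ℝ) (hy : 0 < y) :
    ContDiffAt ℝ ω (fun p : ℝ × ℝ => Fint p.1 p.2) (x, y) := by
  have hz : 0 < ((x : ℂ) + y * Complex.I).im := by simpa using hy
  have hG : AnalyticAt ℂ auxG (x + y * Complex.I) := by
    rw [Complex.analyticAt_iff_eventually_differentiableAt]
    filter_upwards [(isOpen_lt continuous_const Complex.continuous_im).mem_nhds hz] with w hw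
    exact aux_G_diff w hw
  have hG' : ContDiffAt ℝ ω auxG (x + y * Complex.I) := hG.restrictScalars.contDiffAt
  have hl : ContDiff ℝ ω (fun p : ℝ × ℝ => (p.1 : ℂ) + p.2 * Complex.I) := by
    have h1 : ContDiff ℝ ω (fun p : ℝ × ℝ => (p.1 : ℂ)) :=
      Complex.ofRealCLM.contDiff.comp contDiff_fst
    have h2 : ContDiff ℝ ω (fun p : ℝ × ℝ => (p.2 : ℂ)) :=
      Complex.ofRealCLM.contDiff.comp contDiff_snd
    exact h1.add (h2.mul contDiff_const)
  have hc : ContDiffAt ℝ ω (fun p : ℝ × ℝ => auxG ((p.1 : ℂ) + p.2 * Complex.I)) (x, y) :=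
    ContDiffAt.comp (x, y) (g := auxG) hG' hl.contDiffAt
  have him : ContDiffAt ℝ ω (fun p : ℝ × ℝ => (auxG ((p.1 : ℂ) + p.2 * Complex.I)).im) (x, y) :=
    Complex.imCLM.contDiff.contDiffAt.comp (x, y) hc
  have := him.neg.div contDiffAt_snd hy.ne'
  refine this.congr_of_eventuallyEq ?_
  filter_upwards [(isOpen_lt continuous_const continuous_snd).mem_nhds
    (show (0:ℝ) < ((x, y) : ℝ × ℝ).2 from hy)] with p hp
  exact aux_FG p.1 p.2 hp

lemma aux_anti (x : ℝ) {y y' : ℝ} (hy : 0 < y) (h : y ≤ y') : Fint x y' ≤ Fint x y := by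
  refine setIntegral_mono_on (aux_intF x y' (hy.trans_le h)) (aux_intF x y hy)
    measurableSet_Ioi fun t ht => ?_
  have ht : 0 < t := ht
  gcongr

lemma aux_strict (c : ℝ) (hc : 0 < c) (y : ℝ) (hy : 0 < y) :
    Fint (-c) y < ∫ t in Ioi (0:ℝ), t * Real.exp (-t) / (c + t)^2 := by
  have hi : Integrable (fun t : ℝ => t * Real.exp (-t) / (c + t)^2)
      (volume.restrict (Ioi 0)) := by
    refine aux_int_bdd _ (1 / c^2) (by
      have hm : Measurable (fun t : ℝ => t * Real.exp (-t) / (c + t)^2) := by fun_prop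
      exact hm.aestronglyMeasurable) fun t ht => ?_
    have hw : 0 < t * Real.exp (-t) := by positivity
    rw [Real.norm_of_nonneg (by positivity), div_eq_mul_one_div, mul_comm]
    gcongr
    linarith
  rw [← sub_pos, Fint, ← integral_sub hi (aux_intF _ _ hy)]
  refine aux_pos _ (hi.sub (aux_intF _ _ hy)) fun t ht => ?_
  rw [sub_pos]
  have hw : 0 < t * Real.exp (-t) := by positivity
  apply div_lt_div_of_pos_left hw (by positivity)
  nlinarith

/-- `v_α` is continuous on ℝ, real-analytic on `ℝ \ {-c_α}`, with the
stated derivative formula on `(-c_α, ∞)`. -/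
theorem free_gamma_v_continuous_analytic_deriv
    (α : ℝ) (hα : 0 < α) (c : ℝ) (hc : 0 < c)
    (hceq : (∫ t in Set.Ioi (0:ℝ), t * Real.exp (-t) / (c + t)^2) = 1/α)
    (v : ℝ → ℝ) (hv0 : ∀ x ≤ -c, v x = 0)
    (hvpos : ∀ x, -c < x → 0 < v x)
    (hveq : ∀ x, -c < x → Fint x (v x) = 1/α)
    (hvuniq : ∀ x, -c < x → ∀ y, 0 < y → Fint x y = 1/α → y = v x) :
    Continuous v ∧
    (∀ x : ℝ, x ≠ -c → AnalyticAt ℝ v x) ∧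
    (∀ x : ℝ, -c < x → deriv v x =
      -(∫ t in Set.Ioi (0:ℝ), (x - t) * (t * Real.exp (-t)) / ((x - t)^2 + (v x)^2)^2) /
        (v x * ∫ t in Set.Ioi (0:ℝ), t * Real.exp (-t) / ((x - t)^2 + (v x)^2)^2)) := by
  have key : ∀ x : ℝ, -c < x → AnalyticAt ℝ v x := by
    intro x hx
    have hy := hvpos x hx
    have cdf := aux_F_cd x (v x) hy
    have hF := (cdf.differentiableAt (by simp)).hasFDerivAt
    have h01 : fderiv ℝ (fun p : ℝ × ℝ => Fint p.1 p.2) (x, v x) (0, 1) =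
        -2 * v x * ∫ t in Ioi (0:ℝ), (t * Real.exp (-t)) / ((x - t)^2 + (v x)^2)^2 := by
      have hl : HasDerivAt (fun y : ℝ => (x, y)) ((0:ℝ), (1:ℝ)) (v x) :=
        (hasDerivAt_const _ _).prodMk (hasDerivAt_id _)
      exact (hF.comp_hasDerivAt (v x) hl).unique (aux_Fy x (v x) hy)
    have hDpos := aux_pos _ (aux_intD x (v x) hy) (fun t ht => by positivity)
    have hne : fderiv ℝ (fun p : ℝ × ℝ => Fint p.1 p.2) (x, v x) (0, 1) ≠ 0 := by
      rw [h01]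
      have := mul_pos hy hDpos
      linarith
    have if₂ : (fderiv ℝ (fun p : ℝ × ℝ => Fint p.1 p.2) (x, v x) ∘L
        .inr ℝ ℝ ℝ).IsInvertible := by
      refine ⟨ContinuousLinearEquiv.unitsEquivAut ℝ (Units.mk0 _ hne), ?_⟩
      ext
      simp
    have hcd := cdf.contDiffAt_implicitFunction (by simp) if₂
    have hself := cdf.implicitFunction_apply_self (by simp) if₂
    have hev := cdf.eventually_apply_implicitFunction (by simp) if₂
    simp only at hcd hself hev
    refine (hcd.congr_of_eventuallyEq ?_).analyticAt
    have hpos := hcd.continuousAt.eventually (lt_mem_nhds (hself.symm ▸ hy))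
    filter_upwards [hev, hpos, lt_mem_nhds hx] with u h1 h2 h3
    exact (hvuniq u h3 _ h2 (h1.trans (hveq x hx))).symm
  have hlt : ∀ x : ℝ, x < -c → AnalyticAt ℝ v x := by
    intro x hx
    refine (analyticAt_const (v := (0:ℝ))).congr ?_
    filter_upwards [gt_mem_nhds hx] with u hu
    exact (hv0 u hu.le).symm
  have han : ∀ x : ℝ, x ≠ -c → AnalyticAt ℝ v x := by
    intro x hx
    rcases lt_or_gt_of_ne hx with h | h
    · exact hlt x h
    · exact key x h
  refine ⟨?_, han, ?_⟩
  · rw [continuous_iff_continuousAt]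
    intro x
    by_cases hx : x = -c
    · subst hx
      rw [Metric.continuousAt_iff']
      intro ε hε
      have h1 : Fint (-c) (ε/2) < 1/α := hceq ▸ aux_strict c hc (ε/2) (by linarith)
      have h2 := (aux_Fx (-c) (ε/2) (by linarith)).continuousAt.eventually (gt_mem_nhds h1)
      filter_upwards [h2] with u hu
      rw [hv0 (-c) le_rfl, Real.dist_eq, sub_zero]
      rcases le_or_gt u (-c) with h | h
      · rw [hv0 u h]
        simpa using hε
      · rw [abs_of_pos (hvpos u h)]
        by_contra! hcon
        have := aux_anti u (y := ε/2) (y' := v u) (by linarith) (by linarith)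
        rw [hveq u h] at this
        linarith
    · exact (han x hx).continuousAt
  · intro x hx
    have hy := hvpos x hx
    have hF := ((aux_F_cd x (v x) hy).differentiableAt (by simp)).hasFDerivAt
    have h01 : fderiv ℝ (fun p : ℝ × ℝ => Fint p.1 p.2) (x, v x) (0, 1) =
        -2 * v x * ∫ t in Ioi (0:ℝ), (t * Real.exp (-t)) / ((x - t)^2 + (v x)^2)^2 := by
      have hl : HasDerivAt (fun y : ℝ => (x, y)) ((0:ℝ), (1:ℝ)) (v x) :=
        (hasDerivAt_const _ _).prodMk (hasDerivAt_id _)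
      exact (hF.comp_hasDerivAt (v x) hl).unique (aux_Fy x (v x) hy)
    have h10 : fderiv ℝ (fun p : ℝ × ℝ => Fint p.1 p.2) (x, v x) (1, 0) =
        -2 * ∫ t in Ioi (0:ℝ), (x - t) * (t * Real.exp (-t)) / ((x - t)^2 + (v x)^2)^2 := by
      have hl : HasDerivAt (fun u : ℝ => (u, v x)) ((1:ℝ), (0:ℝ)) x :=
        (hasDerivAt_id _).prodMk (hasDerivAt_const _ _)
      exact (HasFDerivAt.comp_hasDerivAt x (f := fun u : ℝ => (u, v x)) hF hl).unique
        (aux_Fx x (v x) hy)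
    have hDpos := aux_pos _ (aux_intD x (v x) hy) (fun t ht => by positivity)
    have hvd := (key x hx).differentiableAt.hasDerivAt
    have hcomp := HasFDerivAt.comp_hasDerivAt x (f := fun u : ℝ => (u, v u)) hF
      ((hasDerivAt_id x).prodMk hvd)
    have hconst : HasDerivAt ((fun p : ℝ × ℝ => Fint p.1 p.2) ∘ fun u : ℝ => (u, v u)) 0 x := by
      refine (hasDerivAt_const x (1/α)).congr_of_eventuallyEq ?_
      filter_upwards [lt_mem_nhds hx] with u hu
      exact hveq u hu
    have h0 := hcomp.unique hconst
    rw [show ((1:ℝ), deriv v x) = ((1:ℝ), (0:ℝ)) + deriv v x • ((0:ℝ), (1:ℝ)) by simp,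
      map_add, map_smul, h01, h10, smul_eq_mul] at h0
    rw [eq_div_iff (mul_pos hy hDpos).ne']
    linarith
end

section
/- Let α > 0. The number s_α := P_α(-c_α) = H_α(-c_α) is strictly positive. -/
open MeasureTheory Set Filter

/-- `s_α := P_α(-c_α) = H_α(-c_α)` is strictly positive. -/
theorem free_gamma_s_alpha_pos
    (α : ℝ) (hα : 0 < α) (c : ℝ) (hc : 0 < c)
    (hceq : (∫ t in Set.Ioi (0:ℝ), t * Real.exp (-t) / (c + t)^2) = 1/α)
    (v : ℝ → ℝ) (hv0 : ∀ x ≤ -c, v x = 0)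
    (hvpos : ∀ x, -c < x → 0 < v x)
    (hveq : ∀ x, -c < x → Fint x (v x) = 1/α)
    (hvuniq : ∀ x, -c < x → ∀ y, 0 < y → Fint x y = 1/α → y = v x)
    (P : ℝ → ℝ)
    (hP : ∀ x : ℝ, ((P x : ℝ) : ℂ) = Hfun α ((x : ℂ) + (v x : ℝ) * Complex.I))
    (s : ℝ) (hs : s = P (-c)) :
    0 < s := by
  have h1 : IntegrableOn (fun t : ℝ => Real.exp (-t)) (Ioi 0) := integrableOn_exp_neg_Ioi 0
  have h2 : IntegrableOn (fun t : ℝ => t * Real.exp (-t) / (c + t)) (Ioi 0) := by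
    refine Integrable.mono' h1 (Measurable.aestronglyMeasurable (by fun_prop)) ?_
    refine (ae_restrict_iff' measurableSet_Ioi).2 (Eventually.of_forall fun t ht => ?_)
    have ht : 0 < t := ht
    have he := Real.exp_pos (-t)
    rw [Real.norm_of_nonneg (by positivity), div_le_iff₀ (by positivity)]
    nlinarith [mul_pos hc he]
  have h3 : IntegrableOn (fun t : ℝ => c * (t * Real.exp (-t) / (c + t)^2)) (Ioi 0) := by
    refine Integrable.mono' h1 (Measurable.aestronglyMeasurable (by fun_prop)) ?_
    refine (ae_restrict_iff' measurableSet_Ioi).2 (Eventually.of_forall fun t ht => ?_)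
    have ht : 0 < t := ht
    have he := Real.exp_pos (-t)
    rw [Real.norm_of_nonneg (by positivity), ← mul_div_assoc, div_le_iff₀ (by positivity)]
    have : c * t ≤ (c + t)^2 := by nlinarith [mul_pos hc ht]
    nlinarith [mul_le_mul_of_nonneg_right this he.le]
  have hpos : 0 < ∫ t in Ioi (0:ℝ), (Real.exp (-t) - t * Real.exp (-t) / (c + t)
      - c * (t * Real.exp (-t) / (c + t)^2)) := by
    have key : ∀ t ∈ Ioi (0:ℝ), 0 < Real.exp (-t) - t * Real.exp (-t) / (c + t)
      - c * (t * Real.exp (-t) / (c + t)^2) := by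
      intro t ht
      have ht : 0 < t := ht
      have : Real.exp (-t) - t * Real.exp (-t) / (c + t)
        - c * (t * Real.exp (-t) / (c + t)^2) = c^2 * Real.exp (-t) / (c + t)^2 := by
        field_simp
        ring
      rw [this]
      positivity
    rw [setIntegral_pos_iff_support_of_nonneg_ae
      ((ae_restrict_iff' measurableSet_Ioi).2 (Eventually.of_forall fun t ht => (key t ht).le))
      ((h1.sub h2).sub h3)]
    rw [inter_eq_right.2 (fun t ht => Function.mem_support.2 (key t ht).ne')]
    simp
  have e1 := integral_sub (h1.sub h2) h3
  have e2 := integral_sub h1 h2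
  simp only [Pi.sub_apply] at e1
  rw [e1, e2, integral_exp_neg_Ioi_zero, integral_const_mul, hceq] at hpos
  have hI : (∫ t in Set.Ioi (0:ℝ), ((t * Real.exp (-t) : ℝ) : ℂ) / (((-c : ℝ) : ℂ) - (t : ℂ)))
      = ((-∫ t in Set.Ioi (0:ℝ), t * Real.exp (-t) / (c + t) : ℝ) : ℂ) := by
    rw [← integral_neg, ← integral_complex_ofReal]
    congr 1
    ext t
    rw [← Complex.ofReal_sub, ← Complex.ofReal_div, ← div_neg]
    congr 2
    ring
  have h := hP (-c)
  rw [hv0 _ le_rfl, Hfun, Complex.ofReal_zero, zero_mul, add_zero, hI] at h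
  norm_cast at h
  rw [hs, h]
  have := mul_pos hα hpos
  have e : α * (c * (1 / α)) = c := by field_simp
  nlinarith
end

section
/- Let α > 0. The function P_α is continuous on ℝ, real-analytic on ℝ∖{-c_α}, is a strictly increasing bijection of ℝ onto ℝ, and P_α′(x) > 0 for all x ∈ ℝ∖{-c_α}. -/
open MeasureTheory Set Filter

open Topology

namespace FreeGamma

theorem w_int : IntegrableOn (fun t : ℝ => t * Real.exp (-t)) (Ioi 0) := by
  have h := Real.GammaIntegral_convergent (s := 2) (by norm_num)
  refine h.congr_fun (fun t ht => ?_) measurableSet_Ioi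
  have : (2:ℝ) - 1 = 1 := by norm_num
  simp only [this, Real.rpow_one]; ring

theorem intg {E : Type*} [NormedAddCommGroup E] (f : ℝ → E)
    (hf : AEStronglyMeasurable f (volume.restrict (Ioi 0))) (C : ℝ)
    (h : ∀ t > 0, ‖f t‖ ≤ C * (t * Real.exp (-t))) : IntegrableOn f (Ioi 0) := by
  refine Integrable.mono' (w_int.const_mul C) hf ?_
  filter_upwards [ae_restrict_mem measurableSet_Ioi] with t ht using h t ht

theorem int_pos (f : ℝ → ℝ) (hf : IntegrableOn f (Ioi 0)) (h : ∀ t > 0, 0 < f t) :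
    0 < ∫ t in Ioi (0:ℝ), f t := by
  rw [setIntegral_pos_iff_support_of_nonneg_ae _ hf]
  · have : Function.support f ∩ Ioi 0 = Ioi 0 := by
      ext t; simp only [mem_inter_iff, Function.mem_support, mem_Ioi, and_iff_right_iff_imp]
      intro ht; exact (h t ht).ne'
    rw [this]; simp
  · filter_upwards [ae_restrict_mem measurableSet_Ioi] with t ht using (h t ht).le

theorem int_lt (f g : ℝ → ℝ) (hf : IntegrableOn f (Ioi 0)) (hg : IntegrableOn g (Ioi 0))
    (h : ∀ t > 0, f t < g t) :
    ∫ t in Ioi (0:ℝ), f t < ∫ t in Ioi (0:ℝ), g t := by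
  have := int_pos (fun t => g t - f t) (hg.sub hf) (fun t ht => sub_pos.2 (h t ht))
  rw [integral_sub hg hf] at this
  linarith

/-- the domain -/
def U : Set ℂ := {z | z.re < 0 ∨ 0 < z.im}

theorem U_open : IsOpen U :=
  (isOpen_lt Complex.continuous_re continuous_const).union
    (isOpen_lt continuous_const Complex.continuous_im)

theorem U_bound {z : ℂ} (hz : z ∈ U) :
    ∃ δ > 0, ∀ w ∈ Metric.ball z δ, ∀ t : ℝ, 0 < t → δ ≤ ‖w - t‖ := by
  rcases hz with hz | hz
  · refine ⟨-z.re / 2, by linarith, fun w hw t ht => ?_⟩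
    rw [mem_ball_iff_norm] at hw
    have h1 := (Complex.abs_re_le_norm (w - z)).trans hw.le
    have h2 := Complex.abs_re_le_norm (w - t)
    simp only [Complex.sub_re, Complex.ofReal_re] at h1 h2
    have := neg_le_abs (w.re - t)
    have := le_abs_self (w.re - z.re)
    linarith
  · refine ⟨z.im / 2, by linarith, fun w hw t ht => ?_⟩
    rw [mem_ball_iff_norm] at hw
    have h1 := (Complex.abs_im_le_norm (w - z)).trans hw.le
    have h2 := Complex.abs_im_le_norm (w - t)
    simp only [Complex.sub_im, Complex.ofReal_im] at h1 h2
    have := le_abs_self (w.im - 0)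
    have := neg_le_abs (w.im - z.im)
    linarith

theorem G_int {z : ℂ} (hz : z ∈ U) (n : ℕ) : IntegrableOn
    (fun t : ℝ => ((t * Real.exp (-t) : ℝ) : ℂ) / (z - (t : ℂ)) ^ n) (Ioi 0) := by
  obtain ⟨δ, hδ, h⟩ := U_bound hz
  refine intg _ (Measurable.aestronglyMeasurable (by fun_prop)) ((δ ^ n)⁻¹) (fun t ht => ?_)
  have h1 := h z (Metric.mem_ball_self hδ) t ht
  have h0 : 0 < t * Real.exp (-t) := by positivity
  rw [norm_div, norm_pow, Complex.norm_real, Real.norm_of_nonneg h0.le, div_eq_inv_mul]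
  gcongr

theorem H_deriv (α : ℝ) {z : ℂ} (hz : z ∈ U) : HasDerivAt (Hfun α)
    (1 - α * ∫ t in Ioi (0:ℝ), ((t * Real.exp (-t) : ℝ) : ℂ) / (z - (t : ℂ)) ^ 2) z := by
  obtain ⟨δ, hδ, h⟩ := U_bound hz
  have key := (hasDerivAt_integral_of_dominated_loc_of_deriv_le (𝕜 := ℂ)
    (μ := volume.restrict (Ioi (0:ℝ)))
    (F := fun z t => ((t * Real.exp (-t) : ℝ) : ℂ) / (z - (t : ℂ)))
    (F' := fun z t => -(((t * Real.exp (-t) : ℝ) : ℂ) / (z - (t : ℂ)) ^ 2))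
    (bound := fun t => (δ ^ 2)⁻¹ * (t * Real.exp (-t)))
    (x₀ := z) (Metric.ball_mem_nhds z hδ)
    (Eventually.of_forall fun w => Measurable.aestronglyMeasurable (by fun_prop))
    (by have := G_int hz 1; simp only [pow_one] at this; exact this)
    (Measurable.aestronglyMeasurable (by fun_prop)) ?_ (w_int.const_mul _) ?_).2
  · rw [integral_neg] at key
    have := ((hasDerivAt_id z).add_const (α : ℂ)).add (key.const_mul (α : ℂ))
    refine this.congr_deriv ?_
    ring
  · filter_upwards [ae_restrict_mem measurableSet_Ioi] with t ht w hw
    have h1 := h w hw t ht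
    have ht' : 0 < t := ht
    have h0 : 0 < t * Real.exp (-t) := by positivity
    rw [norm_neg, norm_div, norm_pow, Complex.norm_real, Real.norm_of_nonneg h0.le, div_eq_inv_mul]
    gcongr
  · filter_upwards [ae_restrict_mem measurableSet_Ioi] with t ht w hw
    have h1 := h w hw t ht
    have hne : w - t ≠ 0 := by
      intro h2; rw [h2, norm_zero] at h1; linarith
    have := (((hasDerivAt_id w).sub_const (t : ℂ)).inv hne).const_mul
      (((t * Real.exp (-t) : ℝ) : ℂ))
    refine (this.congr_deriv ?_)
    simp only [id]
    field_simp

theorem H_an (α : ℝ) {z : ℂ} (hz : z ∈ U) : AnalyticAt ℂ (Hfun α) z := by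
  have : DifferentiableOn ℂ (Hfun α) U :=
    fun w hw => (H_deriv α hw).differentiableAt.differentiableWithinAt
  exact this.analyticAt (U_open.mem_nhds hz)

theorem D_eq (x y t : ℝ) : ‖((x : ℂ) + y * Complex.I) - t‖ ^ 2 = (x - t) ^ 2 + y ^ 2 := by
  rw [← Complex.normSq_eq_norm_sq, Complex.normSq_apply]; simp; ring

theorem D_low {x y : ℝ} (hz : (x : ℂ) + y * Complex.I ∈ U) :
    ∃ δ > 0, ∀ t > 0, δ ≤ (x - t) ^ 2 + y ^ 2 := by
  obtain ⟨δ, hδ, h⟩ := U_bound hz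
  refine ⟨δ ^ 2, by positivity, fun t ht => ?_⟩
  have := h _ (Metric.mem_ball_self hδ) t ht
  rw [← D_eq]
  gcongr

theorem D_pos {x y : ℝ} (hz : (x : ℂ) + y * Complex.I ∈ U) {t : ℝ} (ht : 0 < t) :
    0 < (x - t) ^ 2 + y ^ 2 := by
  obtain ⟨δ, hδ, h⟩ := D_low hz
  exact hδ.trans_le (h t ht)

theorem F_int {x y : ℝ} (hz : (x : ℂ) + y * Complex.I ∈ U) (n : ℕ) : IntegrableOn
    (fun t : ℝ => t * Real.exp (-t) / ((x - t) ^ 2 + y ^ 2) ^ n) (Ioi 0) := by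
  obtain ⟨δ, hδ, h⟩ := D_low hz
  refine intg _ (Measurable.aestronglyMeasurable (by fun_prop)) ((δ ^ n)⁻¹) (fun t ht => ?_)
  have h1 := h t ht
  have h0 : 0 < t * Real.exp (-t) := by positivity
  have h2 : 0 < (x - t) ^ 2 + y ^ 2 := hδ.trans_le h1
  rw [Real.norm_of_nonneg (by positivity), div_eq_inv_mul]
  gcongr

theorem F_int1 {x y : ℝ} (hz : (x : ℂ) + y * Complex.I ∈ U) : IntegrableOn
    (fun t : ℝ => t * Real.exp (-t) / ((x - t) ^ 2 + y ^ 2)) (Ioi 0) := by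
  simpa using F_int hz 1

theorem H_im (α : ℝ) {x y : ℝ} (hz : (x : ℂ) + y * Complex.I ∈ U) :
    (Hfun α (x + y * Complex.I)).im = y * (1 - α * Fint x y) := by
  have h1 := Complex.imCLM.integral_comp_comm (G_int hz 1)
  simp only [pow_one, Complex.imCLM_apply] at h1
  have h2 : (∫ t in Ioi (0:ℝ), (((t * Real.exp (-t) : ℝ) : ℂ) / (x + y * Complex.I - (t : ℂ))).im)
      = -y * Fint x y := by
    rw [Fint, ← integral_const_mul]
    refine setIntegral_congr_fun measurableSet_Ioi (fun t ht => ?_)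
    simp only [Complex.div_im, Complex.normSq_eq_norm_sq, D_eq, Complex.ofReal_re, Complex.ofReal_im]
    simp [-Complex.ofReal_mul, -Complex.ofReal_exp]
    ring
  rw [Hfun, Complex.add_im, Complex.im_ofReal_mul, ← h1, h2]
  simp
  ring

theorem H_re (α : ℝ) {x y : ℝ} (hz : (x : ℂ) + y * Complex.I ∈ U) :
    IntegrableOn (fun t => t * Real.exp (-t) * (x - t) / ((x - t) ^ 2 + y ^ 2)) (Ioi (0:ℝ)) ∧ 
    (Hfun α (x + y * Complex.I)).re = x + α + α *
      ∫ t in Ioi (0:ℝ), t * Real.exp (-t) * (x - t) / ((x - t) ^ 2 + y ^ 2) := by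
  have h0 := Complex.reCLM.integrable_comp (G_int hz 1)
  have h1 := Complex.reCLM.integral_comp_comm (G_int hz 1)
  have h3 : ∀ t : ℝ, (((t * Real.exp (-t) : ℝ) : ℂ) / (x + y * Complex.I - (t : ℂ))).re
      = t * Real.exp (-t) * (x - t) / ((x - t) ^ 2 + y ^ 2) := by
    intro t
    simp only [Complex.div_re, Complex.normSq_eq_norm_sq, D_eq, Complex.ofReal_re, Complex.ofReal_im]
    simp [-Complex.ofReal_mul, -Complex.ofReal_exp]
  simp only [pow_one, Complex.reCLM_apply, h3] at h1
  refine ⟨?_, ?_⟩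
  · refine h0.congr (Eventually.of_forall fun t => ?_)
    simp only [pow_one, Complex.reCLM_apply, h3]
  · rw [Hfun, Complex.add_re, Complex.re_ofReal_mul, ← h1]
    simp

/-- Positivity of the real part of the derivative of H on the curve. -/
theorem Hderiv_re (α : ℝ) (hα : 0 < α) {x y : ℝ} (hy : 0 < y) (hF : Fint x y = 1 / α) :
    0 < (1 - α * ∫ t in Ioi (0:ℝ), ((t * Real.exp (-t) : ℝ) : ℂ) /
      ((x : ℂ) + y * Complex.I - (t : ℂ)) ^ 2).re := by
  have hz : (x : ℂ) + y * Complex.I ∈ U := Or.inr (by simpa using hy)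
  have h0 := Complex.reCLM.integrable_comp (G_int hz 2)
  have h1 := Complex.reCLM.integral_comp_comm (G_int hz 2)
  simp only [Complex.reCLM_apply] at h1
  have : (∫ t in Ioi (0:ℝ), (((t * Real.exp (-t) : ℝ) : ℂ) /
      ((x : ℂ) + y * Complex.I - (t : ℂ)) ^ 2).re) < Fint x y := by
    refine int_lt _ _ h0 (F_int1 hz) (fun t ht => ?_)
    have hD := D_pos hz ht
    have hw : 0 < t * Real.exp (-t) := by positivity
    have : (((t * Real.exp (-t) : ℝ) : ℂ) / ((x : ℂ) + y * Complex.I - (t : ℂ)) ^ 2).re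
       = t * Real.exp (-t) / ((x - t) ^ 2 + y ^ 2) -
        2 * y ^ 2 * (t * Real.exp (-t)) / ((x - t) ^ 2 + y ^ 2) ^ 2 := by
      rw [Complex.div_re, Complex.normSq_eq_norm_sq, norm_pow, D_eq, Complex.ofReal_im,
        Complex.ofReal_re, sq (_ - _ : ℂ), Complex.mul_re]
      simp
      field_simp
      ring
    rw [this]
    have : 0 < 2 * y ^ 2 * (t * Real.exp (-t)) / ((x - t) ^ 2 + y ^ 2) ^ 2 := by positivity
    linarith
  rw [Complex.sub_re, Complex.re_ofReal_mul, ← h1, Complex.one_re]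
  rw [hF] at this
  have := mul_lt_mul_of_pos_left this hα
  rw [mul_one_div_cancel hα.ne'] at this
  linarith

theorem right_side (α : ℝ) (hα : 0 < α) (c : ℝ) (v : ℝ → ℝ)
    (hvpos : ∀ x, -c < x → 0 < v x)
    (hveq : ∀ x, -c < x → Fint x (v x) = 1/α)
    (hvuniq : ∀ x, -c < x → ∀ y, 0 < y → Fint x y = 1/α → y = v x)
    (P : ℝ → ℝ)
    (hP : ∀ x : ℝ, ((P x : ℝ) : ℂ) = Hfun α ((x : ℂ) + (v x : ℝ) * Complex.I))
    (x : ℝ) (hx : -c < x) : AnalyticAt ℝ P x ∧ 0 < deriv P x := by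
  set z : ℂ := (x : ℂ) + (v x : ℝ) * Complex.I with hzdef
  have hzre : z.re = x := by simp [hzdef]
  have hzim : z.im = v x := by simp [hzdef]
  have hz : z ∈ U := Or.inr (by rw [hzim]; exact hvpos x hx)
  have hH := H_an α hz
  have hd := H_deriv α hz
  have hre := Hderiv_re α hα (hvpos x hx) (hveq x hx)
  rw [← hzdef, ← hd.deriv] at hre
  have hne : deriv (Hfun α) z ≠ 0 := by
    intro h; rw [h] at hre; simp at hre
  have hKan := hH.analyticAt_localInverse hne
  have hKd := hH.hasStrictDerivAt.to_localInverse hne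
  have hKr := hH.hasStrictDerivAt.eventually_right_inverse hne
  have hKz : hH.hasStrictDerivAt.localInverse _ _ _ hne (Hfun α z) = z :=
    HasStrictFDerivAt.localInverse_apply_image ..
  generalize hH.hasStrictDerivAt.localInverse _ _ _ hne = K at hKan hKd hKr hKz
  rw [← hP x] at hKan hKd hKr hKz
  set q : ℝ → ℝ := fun p => (K p).re with hq
  have hqan : AnalyticAt ℝ q (P x) := hKan.re_ofReal
  have hqd : HasDerivAt q ((deriv (Hfun α) z)⁻¹).re (P x) := hKd.hasDerivAt.real_of_complex
  have hqpos : 0 < ((deriv (Hfun α) z)⁻¹).re := by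
    rw [Complex.inv_re]
    exact div_pos hre (Complex.normSq_pos.2 hne)
  have hqx : q (P x) = x := by rw [hq]; simp only; rw [hKz, hzre]
  have hcont : ContinuousAt (fun p : ℝ => K p) (P x) :=
    ContinuousAt.comp (f := fun p : ℝ => (p : ℂ)) hKan.continuousAt
      Complex.continuous_ofReal.continuousAt
  have e1 : ∀ᶠ p in 𝓝 (P x), -c < (K ((p : ℝ) : ℂ)).re := by
    refine (Complex.continuous_re.continuousAt.comp hcont).eventually_const_lt ?_
    simp only [Function.comp]; rw [hKz, hzre]; exact hx
  have e2 : ∀ᶠ p in 𝓝 (P x), 0 < (K ((p : ℝ) : ℂ)).im := by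
    refine (Complex.continuous_im.continuousAt.comp hcont).eventually_const_lt ?_
    simp only [Function.comp]; rw [hKz, hzim]; exact hvpos x hx
  have e3 : ∀ᶠ p in 𝓝 (P x), Hfun α (K ((p : ℝ) : ℂ)) = p :=
    Complex.continuous_ofReal.continuousAt.eventually hKr
  have hPq : ∀ᶠ p in 𝓝 (P x), P (q p) = p := by
    filter_upwards [e1, e2, e3] with p h1 h2 h3
    have hK : K p = ((K p).re : ℂ) + ((K p).im : ℝ) * Complex.I := (Complex.re_add_im _).symm
    have hU : ((K p).re : ℂ) + ((K p).im : ℝ) * Complex.I ∈ U := by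
      rw [← hK]; exact Or.inr h2
    have him := H_im α hU
    rw [← hK, h3, Complex.ofReal_im] at him
    have h4 : Fint (K p).re (K p).im = 1 / α := by
      rw [eq_div_iff hα.ne']
      rcases mul_eq_zero.1 him.symm with h | h <;> linarith
    have h5 := hvuniq _ h1 _ h2 h4
    have h6 := hP (K p).re
    rw [← h5, ← hK, h3] at h6
    exact_mod_cast h6
  have hderiv : deriv q (P x) = ((deriv (Hfun α) z)⁻¹).re := hqd.deriv
  have hqne : deriv q (P x) ≠ 0 := by rw [hderiv]; exact hqpos.ne'
  constructor
  · have := (analyticAt_comp_iff_of_deriv_ne_zero (g := P) hqan hqne).1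
      (analyticAt_id.congr (hPq.mono fun p hp => hp.symm))
    rwa [hqx] at this
  · have := (hqan.hasStrictDerivAt.to_local_left_inverse hqne hPq).hasDerivAt.deriv
    rw [hqx] at this
    rw [this, hderiv]
    exact inv_pos.2 hqpos

theorem left_side (α : ℝ) (hα : 0 < α) (c : ℝ) (hc : 0 < c)
    (hceq : Fint (-c) 0 = 1/α)
    (v : ℝ → ℝ) (hv0 : ∀ x ≤ -c, v x = 0)
    (P : ℝ → ℝ)
    (hP : ∀ x : ℝ, ((P x : ℝ) : ℂ) = Hfun α ((x : ℂ) + (v x : ℝ) * Complex.I))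
    (x : ℝ) (hx : x < -c) : AnalyticAt ℝ P x ∧ 0 < deriv P x := by
  have hz : (x : ℂ) ∈ U := Or.inl (by simp; linarith)
  have hz0 : (x : ℂ) + (0 : ℝ) * Complex.I ∈ U := by simpa using hz
  have hc0 : ((-c : ℝ) : ℂ) + (0 : ℝ) * Complex.I ∈ U := Or.inl (by simp; linarith)
  have hev : (fun p : ℝ => (Hfun α p).re) =ᶠ[𝓝 x] P := by
    filter_upwards [Iio_mem_nhds hx] with p hp
    have := hP p
    rw [hv0 p (le_of_lt hp)] at this
    simp only [Complex.ofReal_zero, zero_mul, add_zero] at this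
    rw [← this, Complex.ofReal_re]
  refine ⟨((H_an α hz).re_ofReal).congr hev, ?_⟩
  rw [← hev.deriv_eq, (H_deriv α hz).real_of_complex.deriv]
  have h1 : (∫ t in Ioi (0:ℝ), ((t * Real.exp (-t) : ℝ) : ℂ) / ((x : ℂ) - (t : ℂ)) ^ 2)
      = ((Fint x 0 : ℝ) : ℂ) := by
    rw [Fint, ← integral_complex_ofReal]
    congr 1; ext t; push_cast; simp
  have h2 : Fint x 0 < Fint (-c) 0 := by
    refine int_lt _ _ (F_int1 hz0) (F_int1 hc0) (fun t ht => ?_)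
    have hw : 0 < t * Real.exp (-t) := by positivity
    refine div_lt_div_of_pos_left hw (D_pos hc0 ht) ?_
    nlinarith
  rw [h1, ← Complex.ofReal_mul, Complex.sub_re, Complex.one_re, Complex.ofReal_re]
  rw [hceq] at h2
  have := mul_lt_mul_of_pos_left h2 hα
  rw [mul_one_div_cancel hα.ne'] at this
  linarith

theorem F_anti {x y y' : ℝ} (hz : (x : ℂ) + y * Complex.I ∈ U) (hy : 0 ≤ y) (h : y < y') :
    Fint x y' < Fint x y := by
  have hz' : (x : ℂ) + y' * Complex.I ∈ U := Or.inr (by simp; linarith)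
  refine int_lt _ _ (F_int1 hz') (F_int1 hz) (fun t ht => ?_)
  have hw : 0 < t * Real.exp (-t) := by positivity
  refine div_lt_div_of_pos_left hw (D_pos hz ht) ?_
  nlinarith

theorem v_cont (α : ℝ) (hα : 0 < α) (c : ℝ) (hc : 0 < c)
    (hceq : Fint (-c) 0 = 1/α)
    (v : ℝ → ℝ) (hv0 : ∀ x ≤ -c, v x = 0)
    (hvpos : ∀ x, -c < x → 0 < v x)
    (hveq : ∀ x, -c < x → Fint x (v x) = 1/α) : Tendsto v (𝓝 (-c)) (𝓝 0) := by
  have hc0 : ((-c : ℝ) : ℂ) + (0 : ℝ) * Complex.I ∈ U := Or.inl (by simp; linarith)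
  have hnn : ∀ x, 0 ≤ v x := fun x => by
    rcases le_or_gt x (-c) with h | h
    · rw [hv0 x h]
    · exact (hvpos x h).le
  rw [Metric.tendsto_nhds]
  intro ε hε
  have hU : ∀ x : ℝ, (x : ℂ) + ε * Complex.I ∈ U := fun x => Or.inr (by simpa using hε)
  have h1 : 0 < (Hfun α (((-c : ℝ) : ℂ) + ε * Complex.I)).im := by
    rw [H_im α (hU _)]
    have := F_anti hc0 le_rfl hε
    rw [hceq] at this
    have := mul_lt_mul_of_pos_left this hα
    rw [mul_one_div_cancel hα.ne'] at this
    exact mul_pos hε (by linarith)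
  have hcont : ContinuousAt (fun x : ℝ => (Hfun α ((x : ℂ) + ε * Complex.I)).im) (-c) := by
    refine Complex.continuous_im.continuousAt.comp ?_
    exact ContinuousAt.comp (f := fun x : ℝ => (x : ℂ) + ε * Complex.I)
      (H_an α (hU (-c))).continuousAt (by fun_prop)
  filter_upwards [hcont.eventually_const_lt h1] with x hx
  rw [Real.dist_eq, sub_zero, abs_of_nonneg (hnn x)]
  rcases le_or_gt x (-c) with h | h
  · rw [hv0 x h]; exact hε
  by_contra! hle
  rw [H_im α (hU _)] at hx
  have h2 : Fint x (v x) ≤ Fint x ε := by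
    rcases hle.eq_or_lt with h3 | h3
    · rw [h3]
    · exact (F_anti (hU x) hε.le h3).le
  rw [hveq x h] at h2
  have := mul_le_mul_of_nonneg_left h2 hα.le
  rw [mul_one_div_cancel hα.ne'] at this
  nlinarith

theorem re_bound (α : ℝ) (hα : 0 < α) {x y : ℝ} (hy : 0 < y) (hF : Fint x y = 1 / α) :
    x + α - α * (((∫ t in Ioi (0:ℝ), t * Real.exp (-t)) + 1 / α) / 2)
      ≤ (Hfun α (x + y * Complex.I)).re := by
  have hz : (x : ℂ) + y * Complex.I ∈ U := Or.inr (by simpa using hy)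
  obtain ⟨hi, he⟩ := H_re α hz
  rw [he]
  have h1 : -(((∫ t in Ioi (0:ℝ), t * Real.exp (-t)) + Fint x y) / 2) ≤
      ∫ t in Ioi (0:ℝ), t * Real.exp (-t) * (x - t) / ((x - t) ^ 2 + y ^ 2) := by
    rw [Fint, ← integral_add w_int (F_int1 hz), ← integral_div, ← integral_neg]
    refine setIntegral_mono_on ((w_int.add (F_int1 hz)).div_const 2).neg hi measurableSet_Ioi
      (fun t ht => ?_)
    have ht' : 0 < t := ht
    have hD := D_pos hz ht'
    have hw : 0 < t * Real.exp (-t) := by positivity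
    have : t * Real.exp (-t) * (x - t) / ((x - t) ^ 2 + y ^ 2) + 
      (t * Real.exp (-t) + t * Real.exp (-t) / ((x - t) ^ 2 + y ^ 2)) / 2
      = t * Real.exp (-t) * ((x - t + 1) ^ 2 + y ^ 2) / (2 * ((x - t) ^ 2 + y ^ 2)) := by
      field_simp
      ring
    have h3 : 0 ≤ t * Real.exp (-t) * ((x - t + 1) ^ 2 + y ^ 2) / (2 * ((x - t) ^ 2 + y ^ 2)) := by
      positivity
    linarith
  rw [hF] at h1
  have := mul_le_mul_of_nonneg_left h1 hα.le
  linarith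

theorem re_bound_left (α : ℝ) (hα : 0 < α) {x : ℝ} (hx : x < 0) :
    (Hfun α (x + (0 : ℝ) * Complex.I)).re ≤ x + α := by
  have hz : (x : ℂ) + (0 : ℝ) * Complex.I ∈ U := Or.inl (by simpa using hx)
  rw [(H_re α hz).2]
  have : ∫ t in Ioi (0:ℝ), t * Real.exp (-t) * (x - t) / ((x - t) ^ 2 + 0 ^ 2) ≤ 0 := by
    refine setIntegral_nonpos measurableSet_Ioi (fun t ht => ?_)
    have ht' : 0 < t := ht
    have hw : 0 < t * Real.exp (-t) := by positivity
    refine div_nonpos_of_nonpos_of_nonneg ?_ (by positivity)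
    nlinarith
  nlinarith

end FreeGamma

/-- `P_α` is continuous, real-analytic away from `-c_α`, a strictly
increasing bijection of ℝ onto ℝ, with `P_α′ > 0` away from `-c_α`. -/
theorem free_gamma_P_strictly_increasing_bijection
    (α : ℝ) (hα : 0 < α) (c : ℝ) (hc : 0 < c)
    (hceq : (∫ t in Set.Ioi (0:ℝ), t * Real.exp (-t) / (c + t)^2) = 1/α)
    (v : ℝ → ℝ) (hv0 : ∀ x ≤ -c, v x = 0)
    (hvpos : ∀ x, -c < x → 0 < v x)
    (hveq : ∀ x, -c < x → Fint x (v x) = 1/α)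
    (hvuniq : ∀ x, -c < x → ∀ y, 0 < y → Fint x y = 1/α → y = v x)
    (P : ℝ → ℝ)
    (hP : ∀ x : ℝ, ((P x : ℝ) : ℂ) = Hfun α ((x : ℂ) + (v x : ℝ) * Complex.I)) :
    Continuous P ∧
    (∀ x : ℝ, x ≠ -c → AnalyticAt ℝ P x) ∧
    StrictMono P ∧
    Function.Bijective P ∧
    (∀ x : ℝ, x ≠ -c → 0 < deriv P x) := by
  have hc' : Fint (-c) 0 = 1 / α := by
    rw [← hceq, Fint]
    congr 1; ext t; congr 1; ring
  have hPre : ∀ x, P x = (Hfun α ((x : ℂ) + (v x : ℝ) * Complex.I)).re := fun x => by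
    rw [← hP x, Complex.ofReal_re]
  have hall : ∀ x, x ≠ -c → AnalyticAt ℝ P x ∧ 0 < deriv P x := fun x hx => by
    rcases lt_or_gt_of_ne hx with h | h
    · exact FreeGamma.left_side α hα c hc hc' v hv0 P hP x h
    · exact FreeGamma.right_side α hα c v hvpos hveq hvuniq P hP x h
  have hcont : Continuous P := by
    rw [continuous_iff_continuousAt]
    intro x
    by_cases hx : x = -c
    · subst hx
      have hv := FreeGamma.v_cont α hα c hc hc' v hv0 hvpos hveq
      have hvc : ContinuousAt v (-c) := by
        rw [ContinuousAt, hv0 _ le_rfl]; exact hv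
      have hU : ((-c : ℝ) : ℂ) + (v (-c) : ℝ) * Complex.I ∈ FreeGamma.U :=
        Or.inl (by simp; linarith)
      have : P = fun x : ℝ => (Hfun α ((x : ℂ) + (v x : ℝ) * Complex.I)).re := funext hPre
      rw [this]
      refine Complex.continuous_re.continuousAt.comp ?_
      exact ContinuousAt.comp (f := fun x : ℝ => (x : ℂ) + (v x : ℝ) * Complex.I)
        (FreeGamma.H_an α hU).continuousAt (by fun_prop)
    · exact (hall x hx).1.continuousAt
  have hmono : StrictMono P := by
    refine StrictMonoOn.Iic_union_Ici (a := -c) ?_ ?_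
    · refine strictMonoOn_of_deriv_pos (convex_Iic _) hcont.continuousOn (fun x hx => ?_)
      rw [interior_Iic] at hx
      exact (hall x (ne_of_lt hx)).2
    · refine strictMonoOn_of_deriv_pos (convex_Ici _) hcont.continuousOn (fun x hx => ?_)
      rw [interior_Ici] at hx
      exact (hall x (ne_of_gt hx)).2
  refine ⟨hcont, fun x hx => (hall x hx).1, hmono, ⟨hmono.injective, ?_⟩,
    fun x hx => (hall x hx).2⟩
  refine hcont.surjective ?_ ?_
  · set M := α - α * (((∫ t in Ioi (0:ℝ), t * Real.exp (-t)) + 1 / α) / 2) with hM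
    refine tendsto_atTop_mono' atTop (f₁ := fun x => x + M) ?_
      (tendsto_atTop_add_const_right _ _ tendsto_id)
    filter_upwards [eventually_gt_atTop (-c)] with x hx
    rw [hPre]
    have := FreeGamma.re_bound α hα (hvpos x hx) (hveq x hx)
    linarith
  · refine tendsto_atBot_mono' atBot (f₁ := fun x => x + α) ?_
      (tendsto_atBot_add_const_right _ _ tendsto_id)
    filter_upwards [eventually_lt_atBot (-c)] with x hx
    rw [hPre, hv0 x hx.le]
    exact FreeGamma.re_bound_left α hα (by linarith)
end

section
/- Let α > 0. Then lim_{ξ → ∞} f_α(ξ)/(ξ⁻¹ e^{−ξ}) = α e^{α}. -/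
open MeasureTheory Set Filter

lemma fg_mom (n : ℕ) : IntegrableOn (fun t : ℝ => t^n * Real.exp (-t)) (Ioi 0) ∧
    ∫ t in Ioi (0:ℝ), t^n * Real.exp (-t) = n.factorial := by
  have h1 := Real.GammaIntegral_convergent (s := (n:ℝ)+1) (by positivity)
  have h2 := Real.Gamma_eq_integral (s := (n:ℝ)+1) (by positivity)
  have e : (fun x : ℝ => Real.exp (-x) * x ^ ((n:ℝ) + 1 - 1)) =
      fun t : ℝ => t^n * Real.exp (-t) := by
    funext t
    rw [add_sub_cancel_right, Real.rpow_natCast, mul_comm]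
  rw [e] at h1 h2
  exact ⟨h1, by rw [← h2, Real.Gamma_nat_eq_factorial]⟩

lemma fg_w_int : IntegrableOn (fun t : ℝ => t * Real.exp (-t)) (Ioi 0) := by
  simpa using (fg_mom 1).1

lemma fg_w_val : ∫ t in Ioi (0:ℝ), t * Real.exp (-t) = 1 := by
  simpa using (fg_mom 1).2

lemma fg_F_int (x y : ℝ) (hy : 0 < y) :
    IntegrableOn (fun t : ℝ => t * Real.exp (-t) / ((x - t)^2 + y^2)) (Ioi 0) := by
  refine Integrable.mono' (fg_w_int.div_const (y^2)) ?_ ?_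
  · exact (by fun_prop : Measurable _).aestronglyMeasurable
  · filter_upwards [ae_restrict_mem measurableSet_Ioi] with t ht
    have ht : 0 < t := ht
    rw [Real.norm_of_nonneg (by positivity)]
    gcongr
    nlinarith [sq_nonneg (x-t)]

lemma fg_G_int (x y : ℝ) (hy : 0 < y) :
    IntegrableOn (fun t : ℝ => t * Real.exp (-t) * ((x - t) / ((x - t)^2 + y^2))) (Ioi 0) := by
  refine Integrable.mono' ((fg_w_int.add (fg_F_int x y hy)).div_const 2) ?_ ?_
  · exact (by fun_prop : Measurable _).aestronglyMeasurable
  · filter_upwards [ae_restrict_mem measurableSet_Ioi] with t ht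
    have ht : 0 < t := ht
    have hw : 0 < t * Real.exp (-t) := by positivity
    have hd : 0 < (x-t)^2 + y^2 := by positivity
    simp only [norm_mul, norm_div, Real.norm_eq_abs, Pi.add_apply]
    rw [← abs_mul, abs_of_pos hw, abs_of_pos hd, mul_div_assoc', ← sub_nonneg]
    have : (t * Real.exp (-t) + t * Real.exp (-t) / ((x - t)^2 + y^2)) / 2 -
      t * Real.exp (-t) * |x - t| / ((x - t)^2 + y^2) =
      t * Real.exp (-t) * ((x-t)^2 + y^2 + 1 - 2 * |x-t|) / (2 * ((x-t)^2 + y^2)) := by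
      field_simp
    rw [this]
    have : 0 ≤ (x-t)^2 + y^2 + 1 - 2 * |x-t| := by
      rw [← sq_abs (x-t)]; nlinarith [sq_nonneg (|x-t| - 1), sq_nonneg y]
    positivity

/-- pointwise AM-GM bound -/
lemma fg_amgm (x t y l : ℝ) (hy : 0 < y) (hl : 0 < l) :
    |x - t| / ((x-t)^2 + y^2) ≤ l / 2 + 1 / (2 * l) / ((x-t)^2 + y^2) := by
  have hd : 0 < (x-t)^2 + y^2 := by positivity
  rw [add_div' _ _ _ hd.ne']
  gcongr
  rw [← sub_nonneg]
  have : l / 2 * ((x - t) ^ 2 + y ^ 2) + 1 / (2 * l)  - |x-t| =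
    ((l * |x-t| - 1)^2 + l^2 * y^2) / (2 * l) := by
    rw [← sq_abs (x-t)]; field_simp; ring
  rw [this]; positivity

lemma fg_G_bound (x y α : ℝ) (hy : 0 < y) (hF : Fint x y = 1/α) :
    |∫ t in Ioi (0:ℝ), t * Real.exp (-t) * ((x - t) / ((x - t)^2 + y^2))| ≤ 1/2 + 1/(2*α) := by
  rw [← Real.norm_eq_abs]
  have : (1:ℝ)/2 + 1/(2*α) = ∫ t in Ioi (0:ℝ), ((1/2) * (t * Real.exp (-t)) +
      (1/2) * (t * Real.exp (-t) / ((x - t)^2 + y^2))) := by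
    rw [integral_add (fg_w_int.const_mul _) ((fg_F_int x y hy).const_mul _),
      integral_const_mul, integral_const_mul, fg_w_val]
    unfold Fint at hF
    rw [hF]; ring
  rw [this]
  refine norm_integral_le_of_norm_le
    ((fg_w_int.const_mul _).add ((fg_F_int x y hy).const_mul _)) ?_
  filter_upwards [ae_restrict_mem measurableSet_Ioi] with t ht
  have ht : 0 < t := ht
  have hd : 0 < (x-t)^2 + y^2 := by positivity
  have hw : 0 < t * Real.exp (-t) := by positivity
  rw [Real.norm_eq_abs, abs_mul, abs_div, abs_of_pos hw, abs_of_pos hd]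
  have := mul_le_mul_of_nonneg_left (fg_amgm x t y 1 hy one_pos) hw.le
  refine this.trans (le_of_eq ?_)
  ring

lemma fg_G_bound2 (x y α : ℝ) (hx : 0 < x) (hy : 0 < y) (hF : Fint x y = 1/α) :
    |∫ t in Ioi (0:ℝ), t * Real.exp (-t) * ((x - t) / ((x - t)^2 + y^2))|
      ≤ (14 + 1/(2*α)) / x := by
  rw [← Real.norm_eq_abs]
  have i3 := (fg_mom 3).1
  have e : (14 + 1/(2*α)) / x = ∫ t in Ioi (0:ℝ), ((2/x) * (t * Real.exp (-t)) +
      (2/x) * (t^3 * Real.exp (-t)) +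
      (1/(2*x)) * (t * Real.exp (-t) / ((x - t)^2 + y^2))) := by
    rw [integral_add (f := fun t : ℝ => (2/x) * (t * Real.exp (-t)) + (2/x) * (t^3 * Real.exp (-t)))
      ((fg_w_int.const_mul _).add (i3.const_mul _)) ((fg_F_int x y hy).const_mul _),
      integral_add (fg_w_int.const_mul _) (i3.const_mul _),
      integral_const_mul, integral_const_mul, integral_const_mul, fg_w_val, (fg_mom 3).2]
    unfold Fint at hF
    rw [hF]
    simp only [Nat.factorial]
    push_cast
    ring
  rw [e]
  refine norm_integral_le_of_norm_le
    (((fg_w_int.const_mul _).add (i3.const_mul _)).add ((fg_F_int x y hy).const_mul _)) ?_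
  filter_upwards [ae_restrict_mem measurableSet_Ioi] with t ht
  have ht : 0 < t := ht
  have hd : 0 < (x-t)^2 + y^2 := by positivity
  have hw : 0 < t * Real.exp (-t) := by positivity
  rw [Real.norm_eq_abs, abs_mul, abs_div, abs_of_pos hw, abs_of_pos hd]
  have key : |x - t| / ((x-t)^2 + y^2) ≤ 2/x + (2/x) * t^2 + 1/(2*x) / ((x-t)^2 + y^2) := by
    rcases le_or_gt t (x/2) with h | h
    · have h1 : |x - t| / ((x-t)^2 + y^2) ≤ 2/x := by
        rw [abs_of_nonneg (by linarith), div_le_div_iff₀ hd hx]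
        nlinarith [sq_nonneg y]
      have : 0 ≤ (2/x) * t^2 := by positivity
      have : 0 ≤ 1/(2*x) / ((x-t)^2 + y^2) := by positivity
      linarith
    · have h1 := fg_amgm x t y x hy hx
      have h2 : x/2 ≤ (2/x) * t^2 := by
        rw [div_mul_eq_mul_div, le_div_iff₀ hx]; nlinarith
      have : 0 ≤ 2/x := by positivity
      linarith
  refine (mul_le_mul_of_nonneg_left key hw.le).trans (le_of_eq ?_)
  ring

lemma fg_H_re (α x y : ℝ) (hy : 0 < y) :
    (Hfun α ((x : ℂ) + (y : ℝ) * Complex.I)).re = x + α +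
      α * ∫ t in Ioi (0:ℝ), t * Real.exp (-t) * ((x - t) / ((x - t)^2 + y^2)) := by
  have hint : IntegrableOn (fun t : ℝ => ((t * Real.exp (-t) : ℝ) : ℂ) /
      ((x : ℂ) + (y : ℝ) * Complex.I - (t : ℂ))) (Ioi 0) := by
    refine Integrable.mono' (fg_w_int.div_const y) ?_ ?_
    · exact (by fun_prop : Measurable _).aestronglyMeasurable
    · filter_upwards [ae_restrict_mem measurableSet_Ioi] with t ht
      have ht : 0 < t := ht
      rw [norm_div, Complex.norm_real, Real.norm_of_nonneg (by positivity)]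
      gcongr
      have := Complex.abs_im_le_norm ((x : ℂ) + (y : ℝ) * Complex.I - (t : ℂ))
      simp at this
      rw [abs_of_pos hy] at this
      exact this
  unfold Hfun
  have h := integral_re (𝕜 := ℂ) hint
  simp only [RCLike.re_to_complex] at h
  simp only [Complex.add_re, Complex.re_ofReal_mul, ← h]
  congr 1
  · simp
  · congr 1
    apply integral_congr_ae
    filter_upwards with t
    simp only [Complex.div_re, Complex.normSq_apply, Complex.ofReal_re, Complex.ofReal_im]
    simp only [Complex.sub_re, Complex.add_re, Complex.ofReal_re, Complex.mul_re, Complex.I_re,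
      Complex.I_im, Complex.ofReal_im, Complex.sub_im, Complex.add_im, Complex.mul_im]
    ring_nf

lemma fg_H_re_neg (α x : ℝ) (hα : 0 < α) (hx : x < 0) :
    (Hfun α ((x : ℂ) + ((0:ℝ) : ℝ) * Complex.I)).re ≤ x + α := by
  unfold Hfun
  by_cases hint : IntegrableOn (fun t : ℝ => ((t * Real.exp (-t) : ℝ) : ℂ) /
      ((x : ℂ) + ((0:ℝ) : ℝ) * Complex.I - (t : ℂ))) (Ioi 0)
  · have h := integral_re (𝕜 := ℂ) hint
    simp only [RCLike.re_to_complex] at h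
    simp only [Complex.add_re, Complex.re_ofReal_mul, ← h]
    have : (∫ t in Ioi (0:ℝ), (((t * Real.exp (-t) : ℝ) : ℂ) /
      ((x : ℂ) + ((0:ℝ) : ℝ) * Complex.I - (t : ℂ))).re) ≤ 0 := by
      apply integral_nonpos_of_ae
      filter_upwards [ae_restrict_mem measurableSet_Ioi] with t ht
      have ht : 0 < t := ht
      have : ((x : ℂ) + ((0:ℝ) : ℝ) * Complex.I - (t : ℂ)) = ((x - t : ℝ) : ℂ) := by simp
      rw [this, ← Complex.ofReal_div, Complex.ofReal_re]
      apply div_nonpos_of_nonneg_of_nonpos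
      · positivity
      · linarith
    have := mul_nonpos_of_nonneg_of_nonpos hα.le this
    simp at this ⊢
    linarith
  · rw [integral_undef hint]
    simp

lemma fg_arctan (x y d : ℝ) (hy : 0 < y) :
    ∫ t in (x-d)..(x+d), 1 / ((x-t)^2 + y^2) = 2 / y * Real.arctan (d/y) := by
  have hd : ∀ t ∈ uIcc (x-d) (x+d), HasDerivAt (fun t => (1/y) * Real.arctan ((t - x)/y))
      (1 / ((x-t)^2 + y^2)) t := by
    intro t _
    have h1 : HasDerivAt (fun t : ℝ => (t - x)/y) (1/y) t :=
      ((hasDerivAt_id t).sub_const x).div_const y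
    refine (h1.arctan.const_mul (1/y)).congr_deriv ?_
    have : 0 < (x-t)^2 + y^2 := by positivity
    have : 0 < y^2 + (t-x)^2 := by positivity
    field_simp
    ring
  rw [intervalIntegral.integral_eq_sub_of_hasDerivAt hd]
  · have e1 : (x + d - x)/y = d/y := by ring
    have e2 : (x - d - x)/y = -(d/y) := by ring
    rw [e1, e2, Real.arctan_neg]; ring
  · apply Continuous.intervalIntegrable
    refine continuous_const.div (by fun_prop) ?_
    intro t; positivity

lemma fg_near (x y d : ℝ) (hy : 0 < y) (hd : 0 < d) (hdx : d < x) :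
    (x-d) * Real.exp (-(x+d)) * (2 / y * Real.arctan (d/y)) ≤
      (∫ t in (x-d)..(x+d), t * Real.exp (-t) / ((x-t)^2 + y^2)) ∧
    (∫ t in (x-d)..(x+d), t * Real.exp (-t) / ((x-t)^2 + y^2)) ≤
     (x+d) * Real.exp (-(x-d)) * (2 / y * Real.arctan (d/y)) := by
  have c1 : Continuous fun t : ℝ => t * Real.exp (-t) / ((x-t)^2 + y^2) := by
    refine Continuous.div (by fun_prop) (by fun_prop) ?_
    intro t; positivity
  have c2 : Continuous fun t : ℝ => 1 / ((x-t)^2 + y^2) := by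
    refine Continuous.div (by fun_prop) (by fun_prop) ?_
    intro t; positivity
  rw [← fg_arctan x y d hy, ← intervalIntegral.integral_const_mul,
    ← intervalIntegral.integral_const_mul]
  constructor
  · apply intervalIntegral.integral_mono_on (by linarith)
    · exact (c2.const_mul _).intervalIntegrable _ _
    · exact c1.intervalIntegrable _ _
    · rintro t ⟨h1, h2⟩
      rw [mul_one_div]
      have : 0 < x - d := by linarith
      have : 0 ≤ t := by linarith
      gcongr
  · apply intervalIntegral.integral_mono_on (by linarith)
    · exact c1.intervalIntegrable _ _
    · exact (c2.const_mul _).intervalIntegrable _ _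
    · rintro t ⟨h1, h2⟩
      rw [mul_one_div]
      have : 0 < t := by linarith
      have : 0 ≤ x + d := by linarith
      gcongr

lemma fg_far (x y d : ℝ) (hy : 0 < y) (hd : 0 < d) (hdx : d < x) :
    (∫ t in (x-d)..(x+d), t * Real.exp (-t) / ((x-t)^2 + y^2)) ≤ Fint x y ∧
    Fint x y ≤ (∫ t in (x-d)..(x+d), t * Real.exp (-t) / ((x-t)^2 + y^2)) +
      (4/x^2 + 24/(d^2*x^2)) := by
  have hx : 0 < x := hd.trans hdx
  have hsub : Ioc (x-d) (x+d) ⊆ Ioi 0 := fun t ht => by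
    have := ht.1
    simp only [mem_Ioi]; linarith
  have hi := fg_F_int x y hy
  have h := setIntegral_sdiff (μ := volume) (measurableSet_Ioc) hi hsub
  have i3 := (fg_mom 3).1
  have ig := (fg_w_int.const_mul (4/x^2)).add (i3.const_mul (4/(d^2*x^2)))
  rw [intervalIntegral.integral_of_le (by linarith)]
  have h0 : 0 ≤ ∫ t in Ioi 0 \ Ioc (x-d) (x+d), t * Real.exp (-t) / ((x-t)^2 + y^2) := by
    apply setIntegral_nonneg (measurableSet_Ioi.diff measurableSet_Ioc)
    rintro t ⟨ht, _⟩
    have ht : 0 < t := ht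
    positivity
  have h1 : ∫ t in Ioi 0 \ Ioc (x-d) (x+d), t * Real.exp (-t) / ((x-t)^2 + y^2) ≤
      4/x^2 + 24/(d^2*x^2) := by
    calc _ ≤ ∫ t in Ioi 0 \ Ioc (x-d) (x+d), ((4/x^2) * (t * Real.exp (-t)) +
          (4/(d^2*x^2)) * (t^3 * Real.exp (-t))) := by
          apply setIntegral_mono_on (hi.mono_set sdiff_subset)
            (IntegrableOn.mono_set ig sdiff_subset)
            (measurableSet_Ioi.diff measurableSet_Ioc)
          rintro t ⟨ht, ht2⟩
          have ht : 0 < t := ht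
          have hdd : d^2 ≤ (x-t)^2 := by
            by_contra hcon
            push Not at hcon
            have := abs_lt_of_sq_lt_sq hcon hd.le
            rw [abs_lt] at this
            exact ht2 ⟨by linarith, by linarith⟩
          have hD : 0 < (x-t)^2 + y^2 := by positivity
          have key : 1 / ((x-t)^2 + y^2) ≤ 4/x^2 + 4/(d^2*x^2) * t^2 := by
            rcases le_or_gt t (x/2) with h | h
            · have : 1 / ((x-t)^2 + y^2) ≤ 4/x^2 := by
                rw [div_le_div_iff₀ hD (by positivity)]
                nlinarith [sq_nonneg y]
              have : 0 ≤ 4/(d^2*x^2) * t^2 := by positivity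
              linarith
            · have h1 : 1 / ((x-t)^2 + y^2) ≤ 1/d^2 := by
                gcongr
                nlinarith [sq_nonneg y]
              have h2 : 1/d^2 ≤ 4/(d^2*x^2) * t^2 := by
                rw [div_mul_eq_mul_div, div_le_div_iff₀ (by positivity) (by positivity)]
                have : x^2 ≤ 4*t^2 := by nlinarith
                nlinarith [sq_nonneg d, mul_le_mul_of_nonneg_left this (sq_nonneg d)]
              have : 0 ≤ 4/x^2 := by positivity
              linarith
          have hw : 0 < t * Real.exp (-t) := by positivity
          have := mul_le_mul_of_nonneg_left key hw.le
          rw [mul_one_div] at this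
          refine this.trans (le_of_eq ?_)
          simp only [Pi.add_apply]
          ring
      _ ≤ ∫ t in Ioi 0, ((4/x^2) * (t * Real.exp (-t)) +
          (4/(d^2*x^2)) * (t^3 * Real.exp (-t))) := by
          apply setIntegral_mono_set ig
          · filter_upwards [ae_restrict_mem measurableSet_Ioi] with t ht
            have ht : 0 < t := ht
            simp only [Pi.zero_apply, Pi.add_apply]
            positivity
          · exact sdiff_subset.eventuallyLE
      _ = _ := by
          rw [integral_add (fg_w_int.const_mul _) (i3.const_mul _),
            integral_const_mul, integral_const_mul, fg_w_val, (fg_mom 3).2]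
          simp only [Nat.factorial]
          push_cast
          ring
  unfold Fint
  constructor <;> linarith

lemma fg_v_asymp (α : ℝ) (hα : 0 < α) (v : ℝ → ℝ) 
    (hv : ∀ᶠ x in atTop, 0 < v x ∧ Fint x (v x) = 1/α) :
    Tendsto (fun x => v x / (x * Real.exp (-x))) atTop (nhds (Real.pi * α)) := by
  set d : ℝ → ℝ := fun x => (√x)⁻¹ with hd
  set N : ℝ → ℝ := fun x => ∫ t in (x - d x)..(x + d x), t * Real.exp (-t) / ((x-t)^2 + (v x)^2)
    with hN
  have hd0 : Tendsto d atTop (nhds 0) := tendsto_inv_atTop_zero.comp Real.tendsto_sqrt_atTop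
  have hdb : ∀ x, 1 < x → 0 < d x ∧ d x < 1 := by
    intro x hx
    have h1 : 1 < √x := by rw [Real.lt_sqrt zero_le_one]; simpa using hx
    exact ⟨by simp only [hd]; positivity, inv_lt_one_of_one_lt₀ h1⟩
  have hinv : Tendsto (fun x : ℝ => x⁻¹) atTop (nhds 0) := tendsto_inv_atTop_zero
  have hNlim : Tendsto N atTop (nhds (1/α)) := by
    have hlow : Tendsto (fun x : ℝ => 1/α - (4 * (x⁻¹)^2 + 24 * x⁻¹)) atTop (nhds (1/α)) := by
      have := (((hinv.pow 2).const_mul 4).add (hinv.const_mul 24)).const_sub (1/α)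
      simpa using this
    refine tendsto_of_tendsto_of_tendsto_of_le_of_le' hlow tendsto_const_nhds ?_ ?_
    · filter_upwards [hv, eventually_gt_atTop 1] with x ⟨h1, h2⟩ hx
      have := (fg_far x (v x) (d x) h1 (hdb x hx).1 ((hdb x hx).2.trans hx)).2
      rw [h2] at this
      have e : 4/x^2 + 24/((d x)^2*x^2) = 4 * (x⁻¹)^2 + 24 * x⁻¹ := by
        simp only [hd, inv_pow]
        rw [Real.sq_sqrt (by linarith)]
        have : x ≠ 0 := by linarith
        field_simp
      rw [e] at this
      simp only [hN]
      linarith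
    · filter_upwards [hv, eventually_gt_atTop 1] with x ⟨h1, h2⟩ hx
      have := (fg_far x (v x) (d x) h1 (hdb x hx).1 ((hdb x hx).2.trans hx)).1
      rwa [h2] at this
  set U : ℝ → ℝ := fun x => (1 + d x * x⁻¹) * Real.exp (d x) * Real.pi with hU
  have hUlim : Tendsto U atTop (nhds Real.pi) := by
    have := (((hd0.mul hinv).const_add 1).mul ((Real.continuous_exp.tendsto 0).comp hd0)).mul_const
      Real.pi
    simpa using this
  have hup : ∀ᶠ x in atTop, N x * (v x / (x * Real.exp (-x))) ≤ U x := by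
    filter_upwards [hv, eventually_gt_atTop 1] with x ⟨h1, h2⟩ hx
    obtain ⟨d1, d2⟩ := hdb x hx
    have h3 := (fg_near x (v x) (d x) h1 d1 (d2.trans hx)).2
    have hx0 : 0 < x := by linarith
    have h4 : N x ≤ (x+d x) * Real.exp (-(x-d x)) * (2 / v x * (Real.pi/2)) := by
      refine h3.trans ?_
      gcongr
      exact (Real.arctan_lt_pi_div_two _).le
    have h5 : 0 ≤ v x / (x * Real.exp (-x)) := by positivity
    refine (mul_le_mul_of_nonneg_right h4 h5).trans (le_of_eq ?_)
    have : Real.exp (-(x - d x)) = Real.exp (-x) * Real.exp (d x) := by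
      rw [← Real.exp_add]; ring_nf
    rw [this]
    simp only [hU]
    field_simp
  have hNpos : ∀ᶠ x in atTop, 0 < N x := hNlim.eventually (lt_mem_nhds (by positivity))
  have hvd : Tendsto (fun x => v x * √x) atTop (nhds 0) := by
    have hb : Tendsto (fun x => U x * (x^2 * Real.exp (-x)) / N x) atTop (nhds 0) := by
      have := (hUlim.mul (Real.tendsto_pow_mul_exp_neg_atTop_nhds_zero 2)).div hNlim
        (by positivity)
      rw [mul_zero, zero_div] at this
      exact this
    refine tendsto_of_tendsto_of_tendsto_of_le_of_le' tendsto_const_nhds hb ?_ ?_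
    · filter_upwards [hv] with x hx
      have := hx.1
      positivity
    · filter_upwards [hv, hup, hNpos, eventually_gt_atTop 1] with x ⟨h1, _⟩ h2 h3 hx
      have hx0 : 0 < x := by linarith
      have hs : √x ≤ x := by
        rw [Real.sqrt_le_left hx0.le]; nlinarith
      rw [le_div_iff₀ h3]
      calc v x * √x * N x ≤ v x * x * N x := by gcongr
        _ = (N x * (v x / (x * Real.exp (-x)))) * (x^2 * Real.exp (-x)) := by field_simp
        _ ≤ _ := by gcongr
  have hat : Tendsto (fun x => Real.arctan (d x / v x)) atTop (nhds (Real.pi/2)) := by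
    refine (Real.tendsto_arctan_atTop.mono_right nhdsWithin_le_nhds).comp ?_
    have h1 : Tendsto (fun x => v x * √x) atTop (nhdsWithin 0 (Ioi 0)) := by
      rw [tendsto_nhdsWithin_iff]
      refine ⟨hvd, ?_⟩
      filter_upwards [hv, eventually_gt_atTop 0] with x h1 h2
      have := h1.1
      simp only [mem_Ioi]
      positivity
    refine (tendsto_inv_nhdsGT_zero.comp h1).congr ?_
    intro x
    simp only [hd, Function.comp, mul_inv, div_eq_mul_inv]
    ring
  set W : ℝ → ℝ := fun x => (1 - d x * x⁻¹) * Real.exp (-d x) * (2 * Real.arctan (d x / v x))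
    with hW
  have hWlim : Tendsto W atTop (nhds Real.pi) := by
    have h0 : Tendsto (fun x => Real.exp (-d x)) atTop (nhds 1) := by
      have := (Real.continuous_exp.tendsto (-0)).comp hd0.neg
      simpa [Function.comp_def] using this
    have := (((hd0.mul hinv).const_sub 1).mul h0).mul (hat.const_mul 2)
    have e : (1 - 0 * 0) * 1 * (2 * (Real.pi/2)) = Real.pi := by ring
    rw [e] at this
    exact this
  have hlo : ∀ᶠ x in atTop, W x ≤ N x * (v x / (x * Real.exp (-x))) := by
    filter_upwards [hv, eventually_gt_atTop 1] with x ⟨h1, h2⟩ hx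
    obtain ⟨d1, d2⟩ := hdb x hx
    have h3 := (fg_near x (v x) (d x) h1 d1 (d2.trans hx)).1
    have hx0 : 0 < x := by linarith
    have h5 : 0 ≤ v x / (x * Real.exp (-x)) := by positivity
    refine (le_of_eq ?_).trans (mul_le_mul_of_nonneg_right h3 h5)
    have : Real.exp (-(x + d x)) = Real.exp (-x) * Real.exp (-d x) := by
      rw [← Real.exp_add]; ring_nf
    rw [this]
    simp only [hW]
    field_simp
  have hR := tendsto_of_tendsto_of_tendsto_of_le_of_le' hWlim hUlim hlo hup
  have := hR.div hNlim (by positivity)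
  have e : Real.pi / (1/α) = Real.pi * α := by field_simp
  rw [e] at this
  refine this.congr' ?_
  filter_upwards [hNpos] with x hx
  simp only [Pi.div_apply]
  field_simp

/-- `lim_{ξ→∞} f_α(ξ)/(ξ⁻¹ e^{-ξ}) = α e^α`. -/
theorem free_gamma_density_asymptotics_at_infinity
    (α : ℝ) (hα : 0 < α) (c : ℝ) (hc : 0 < c)
    (hceq : (∫ t in Set.Ioi (0:ℝ), t * Real.exp (-t) / (c + t)^2) = 1/α)
    (v : ℝ → ℝ) (hv0 : ∀ x ≤ -c, v x = 0)
    (hvpos : ∀ x, -c < x → 0 < v x)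
    (hveq : ∀ x, -c < x → Fint x (v x) = 1/α)
    (hvuniq : ∀ x, -c < x → ∀ y, 0 < y → Fint x y = 1/α → y = v x)
    (P : ℝ → ℝ)
    (hP : ∀ x : ℝ, ((P x : ℝ) : ℂ) = Hfun α ((x : ℂ) + (v x : ℝ) * Complex.I))
    (Pinv : ℝ → ℝ)
    (hPinv₁ : Function.LeftInverse Pinv P)
    (hPinv₂ : Function.RightInverse Pinv P)
    (s : ℝ) (hs : s = P (-c))
    (f : ℝ → ℝ) (hf0 : ∀ ξ ≤ s, f ξ = 0)
    (hf1 : ∀ ξ, s < ξ → f ξ =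
      (1 / Real.pi) * (v (Pinv ξ) / ((Pinv ξ)^2 + (v (Pinv ξ))^2))) :
    Filter.Tendsto (fun ξ => f ξ / (ξ⁻¹ * Real.exp (-ξ))) Filter.atTop
      (nhds (α * Real.exp α)) := by
  have hPre : ∀ x, -c < x → P x = x + α +
      α * ∫ t in Ioi (0:ℝ), t * Real.exp (-t) * ((x - t) / ((x - t)^2 + (v x)^2)) := by
    intro x hx
    rw [← fg_H_re α x (v x) (hvpos x hx), ← hP x, Complex.ofReal_re]
  have hPle : ∀ x, P x ≤ x + α + α * (1/2 + 1/(2*α)) := by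
    intro x
    rcases le_or_gt x (-c) with h | h
    · have h1 := fg_H_re_neg α x hα (by linarith)
      have h2 := hP x
      rw [hv0 x h] at h2
      rw [← h2, Complex.ofReal_re] at h1
      have : 0 ≤ α * (1/2 + 1/(2*α)) := by positivity
      linarith
    · rw [hPre x h]
      have := (le_abs_self _).trans (fg_G_bound x (v x) α (hvpos x h) (hveq x h))
      gcongr
  have hPinv : Tendsto Pinv atTop atTop := by
    have h1 : Tendsto (fun ξ : ℝ => ξ + -(α + α * (1/2 + 1/(2*α)))) atTop atTop :=
      tendsto_atTop_add_const_right _ _ tendsto_id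
    refine tendsto_atTop_mono ?_ h1
    intro ξ
    have := hPle (Pinv ξ)
    rw [hPinv₂ ξ] at this
    linarith
  have hPlim : Tendsto (fun x => P x - x) atTop (nhds α) := by
    have h1 : Tendsto (fun x =>
        ∫ t in Ioi (0:ℝ), t * Real.exp (-t) * ((x - t) / ((x - t)^2 + (v x)^2))) atTop
        (nhds 0) := by
      refine squeeze_zero_norm' (a := fun x => (14 + 1/(2*α)) / x) ?_ ?_
      · filter_upwards [eventually_gt_atTop 0] with x hx
        have hx' : -c < x := by linarith
        exact fg_G_bound2 x (v x) α hx (hvpos x hx') (hveq x hx')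
      · exact tendsto_const_nhds.div_atTop tendsto_id
    have h2 := (h1.const_mul α).const_add α
    rw [mul_zero, add_zero] at h2
    refine h2.congr' ?_
    filter_upwards [eventually_gt_atTop (-c)] with x hx
    rw [hPre x hx]; ring
  have hvas := fg_v_asymp α hα v (by
    filter_upwards [eventually_gt_atTop (-c)] with x hx
    exact ⟨hvpos x hx, hveq x hx⟩)
  have hinv : Tendsto (fun x : ℝ => x⁻¹) atTop (nhds 0) := tendsto_inv_atTop_zero
  have hexp : Tendsto (fun x : ℝ => Real.exp (-x)) atTop (nhds 0) :=
    Real.tendsto_exp_neg_atTop_nhds_zero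
  have hmain : Tendsto (fun x => (1/Real.pi) * (v x / (x * Real.exp (-x))) *
      (1 + (v x / (x * Real.exp (-x)) * Real.exp (-x))^2)⁻¹ * (1 + (P x - x) * x⁻¹) *
      Real.exp (P x - x)) atTop (nhds (α * Real.exp α)) := by
    have h1 := ((((hvas.mul hexp).pow 2).const_add 1).inv₀ (by norm_num))
    have h2 := (((hvas.const_mul (1/Real.pi)).mul h1).mul
      ((hPlim.mul hinv).const_add 1)).mul ((Real.continuous_exp.tendsto α).comp hPlim)
    have e : 1/Real.pi * (Real.pi * α) * (1 + (Real.pi * α * 0)^2)⁻¹ * (1 + α * 0) * Real.exp α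
        = α * Real.exp α := by
      have := Real.pi_pos
      field_simp
      norm_num
    rw [e] at h2
    exact h2
  refine (hmain.comp hPinv).congr' ?_
  filter_upwards [eventually_gt_atTop s, eventually_gt_atTop 0,
    hPinv.eventually (eventually_gt_atTop 0)] with ξ h1 h2 h3
  rw [hf1 ξ h1]
  simp only [Function.comp, hPinv₂ ξ]
  set x := Pinv ξ
  have hvx := hvpos x (by linarith)
  have e1 : Real.exp (ξ - x) = Real.exp (-x) / Real.exp (-ξ) := by
    rw [← Real.exp_sub]; ring_nf
  rw [e1]
  have e2 : v x / (x * Real.exp (-x)) * Real.exp (-x) = v x / x := by field_simp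
  rw [e2]
  have e3 : (1 + (v x / x)^2)⁻¹ = x^2 / (x^2 + (v x)^2) := by field_simp
  rw [e3]
  have e4 : 1 + (ξ - x) * x⁻¹ = ξ / x := by field_simp; ring
  rw [e4]
  field_simp
end

section
/- For each R > 0 define Φ_R : (0, π) → (0, ∞) by Φ_R(θ) = F(R sin(θ) e^{iθ}) = ∫₀^∞ u e^{−uR sin(θ)}/(1 − 2u cos(θ) + u²) du. Then for every R > 0 there exists a unique θ_R ∈ (0, π) such that Φ_R is strictly decreasing on (0, θ_R] and strictly increasing on [θ_R, π). -/
open MeasureTheory Set Filter Real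

namespace FreeGamma

noncomputable def D (a t : ℝ) : ℝ := 1 + 2 * a * t + t ^ 2 * (1 + a ^ 2)

lemma D_lower (a t : ℝ) : (1 + a ^ 2)⁻¹ ≤ D a t := by
  have h : 0 < 1 + a ^ 2 := by positivity
  rw [inv_le_iff_one_le_mul₀' h]
  unfold D
  nlinarith [sq_nonneg (t * (1 + a ^ 2) + a)]

lemma D_pos_s17 (a t : ℝ) : 0 < D a t :=
  lt_of_lt_of_le (by positivity) (D_lower a t)

lemma D_inv (a t : ℝ) : (D a t)⁻¹ ≤ 1 + a ^ 2 := by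
  have h := D_lower a t
  have h2 := inv_anti₀ (by positivity) h
  simpa using h2

lemma int_pow (c : ℝ) (hc : 0 < c) (n : ℕ) :
    IntegrableOn (fun t : ℝ => t ^ n * Real.exp (-(c * t))) (Ioi 0) := by
  have h := integrableOn_rpow_mul_exp_neg_mul_rpow (s := (n : ℝ)) (p := 1) (b := c)
    (by have : (0:ℝ) ≤ n := Nat.cast_nonneg n
        linarith) (by norm_num) hc
  refine h.congr_fun (fun t _ => ?_) measurableSet_Ioi
  simp

lemma integral_pos' (f : ℝ → ℝ) (hf : IntegrableOn f (Ioi 0)) (h0 : ∀ t ∈ Ioi (0:ℝ), 0 ≤ f t)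
    (h1 : ∀ t ∈ Ioo (0:ℝ) 1, 0 < f t) : 0 < ∫ t in Ioi (0:ℝ), f t := by
  rw [setIntegral_pos_iff_support_of_nonneg_ae]
  · refine lt_of_lt_of_le ?_ (measure_mono (s := Ioo (0:ℝ) 1) ?_)
    · simp
    · intro t ht
      exact ⟨(h1 t ht).ne', ht.1⟩
  · exact (ae_restrict_iff' measurableSet_Ioi).2 (Eventually.of_forall h0)
  · exact hf

noncomputable def g (R a t : ℝ) : ℝ := t * Real.exp (-(R * t)) * ((1 + a ^ 2) / D a t)

noncomputable def h (R a t : ℝ) : ℝ :=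
  t * Real.exp (-(R * t)) * (2 * (a - t * (1 - a ^ 2)) / (D a t) ^ 2)

lemma g_deriv (R a t : ℝ) : HasDerivAt (fun a => g R a t) (h R a t) a := by
  unfold g h
  refine HasDerivAt.const_mul _ ?_
  have hD : HasDerivAt (fun a => D a t) (2 * t + t ^ 2 * (2 * a)) a := by
    unfold D
    have h1 := (((hasDerivAt_id a).const_mul 2).mul_const t).const_add 1
    have h2 := ((((hasDerivAt_id a).pow 2).const_add 1).const_mul (t ^ 2))
    refine (h1.add h2).congr_deriv ?_
    simp
  have hN : HasDerivAt (fun a : ℝ => 1 + a ^ 2) (2 * a) a := by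
    have h2 := (((hasDerivAt_id a).pow 2).const_add 1)
    refine h2.congr_deriv ?_
    simp
  refine (hN.div hD (D_pos_s17 a t).ne').congr_deriv ?_
  congr 1
  unfold D
  ring

lemma cont_D (a : ℝ) : Continuous (D a) := by unfold D; fun_prop

lemma cont_g (R a : ℝ) : Continuous (g R a) := by
  unfold g
  have := cont_D a
  have h2 := fun t => (D_pos_s17 a t).ne'
  fun_prop (disch := simp_all)

lemma cont_h (R a : ℝ) : Continuous (h R a) := by
  unfold h
  have := cont_D a
  have h2 : ∀ t, (D a t) ^ 2 ≠ 0 := fun t => pow_ne_zero _ (D_pos_s17 a t).ne'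
  fun_prop (disch := simp_all)

lemma cont_h' (R t : ℝ) : Continuous (fun a => h R a t) := by
  unfold h
  have : Continuous (fun a => D a t) := by unfold D; fun_prop
  have h2 : ∀ a, (D a t) ^ 2 ≠ 0 := fun a => pow_ne_zero _ (D_pos_s17 a t).ne'
  fun_prop (disch := simp_all)

noncomputable def bd (R M t : ℝ) : ℝ :=
  (2 * M * (1 + M ^ 2) ^ 2) * (t ^ 1 * Real.exp (-(R * t)))
    + (2 * (1 + M ^ 2) ^ 3) * (t ^ 2 * Real.exp (-(R * t)))

lemma bd_int (R M : ℝ) (hR : 0 < R) : IntegrableOn (bd R M) (Ioi 0) :=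
  ((int_pow R hR 1).const_mul _).add ((int_pow R hR 2).const_mul _)

lemma h_bd (R M a t : ℝ) (ha : |a| ≤ M) (ht : 0 < t) : ‖h R a t‖ ≤ bd R M t := by
  have hM : 0 ≤ M := (abs_nonneg a).trans ha
  have ha2 : a ^ 2 ≤ M ^ 2 := by
    rw [← sq_abs]; gcongr
  have e0 := Real.exp_pos (-(R * t))
  have hDi : (D a t)⁻¹ ≤ 1 + M ^ 2 := (D_inv a t).trans (by linarith)
  have hDp : 0 ≤ (D a t)⁻¹ := (inv_pos.2 (D_pos_s17 a t)).le
  have hn : |a - t * (1 - a ^ 2)| ≤ M + t * (1 + M ^ 2) := by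
    obtain ⟨h1, h2⟩ := abs_le.1 ha
    rw [abs_le]
    constructor <;> nlinarith [mul_le_mul_of_nonneg_left ha2 ht.le, mul_nonneg ht.le (sq_nonneg a),
      mul_nonneg ht.le (sq_nonneg M)]
  have : ‖h R a t‖ = t * Real.exp (-(R * t)) * (2 * |a - t * (1 - a ^ 2)| * ((D a t)⁻¹) ^ 2) := by
    unfold h
    rw [Real.norm_eq_abs, abs_mul, abs_div, abs_mul, abs_mul, abs_of_pos ht, abs_of_pos e0,
      abs_of_pos (two_pos), abs_of_pos (pow_pos (D_pos_s17 a t) 2), div_eq_mul_inv, inv_pow]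
  rw [this]
  calc _ ≤ t * Real.exp (-(R * t)) * (2 * (M + t * (1 + M ^ 2)) * (1 + M ^ 2) ^ 2) := by gcongr
    _ = bd R M t := by unfold bd; ring

lemma h_int (R a : ℝ) (hR : 0 < R) : IntegrableOn (h R a) (Ioi 0) := by
  refine (bd_int R |a| hR).mono' (cont_h R a).aestronglyMeasurable ?_
  refine (ae_restrict_iff' measurableSet_Ioi).2 (Eventually.of_forall fun t ht => ?_)
  exact h_bd R |a| a t le_rfl ht

lemma g_nonneg (R a t : ℝ) (ht : 0 ≤ t) : 0 ≤ g R a t := by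
  unfold g
  have := D_pos_s17 a t
  positivity

lemma g_int (R a : ℝ) (hR : 0 < R) : IntegrableOn (g R a) (Ioi 0) := by
  refine ((int_pow R hR 1).const_mul ((1 + a ^ 2) * (1 + a ^ 2))).mono'
    (cont_g R a).aestronglyMeasurable ?_
  refine (ae_restrict_iff' measurableSet_Ioi).2 (Eventually.of_forall fun t ht => ?_)
  have ht' : (0:ℝ) < t := ht
  rw [Real.norm_eq_abs, abs_of_nonneg (g_nonneg R a t ht'.le)]
  unfold g
  rw [div_eq_mul_inv]
  calc _ ≤ t * Real.exp (-(R * t)) * ((1 + a ^ 2) * (1 + a ^ 2)) := by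
        have := D_inv a t
        gcongr
    _ = _ := by ring

noncomputable def G (R a : ℝ) : ℝ := ∫ t in Ioi (0:ℝ), g R a t
noncomputable def H (R a : ℝ) : ℝ := ∫ t in Ioi (0:ℝ), h R a t

lemma G_deriv (R : ℝ) (hR : 0 < R) (a : ℝ) : HasDerivAt (G R) (H R a) a := by
  refine (hasDerivAt_integral_of_dominated_loc_of_deriv_le (F := g R) (F' := h R)
    (bound := bd R (|a| + 1)) (Metric.ball_mem_nhds a one_pos) ?_ (g_int R a hR)
    (cont_h R a).aestronglyMeasurable ?_ (bd_int R _ hR) ?_).2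
  · exact Eventually.of_forall fun b => (cont_g R b).aestronglyMeasurable
  · refine (ae_restrict_iff' measurableSet_Ioi).2 (Eventually.of_forall fun t ht b hb => ?_)
    refine h_bd R _ b t ?_ ht
    rw [Metric.mem_ball, Real.dist_eq] at hb
    have := abs_sub_abs_le_abs_sub b a
    linarith
  · exact Eventually.of_forall fun t b _ => g_deriv R b t

lemma H_cont (R : ℝ) (hR : 0 < R) : ContinuousOn (H R) (Icc 0 1) := by
  refine continuousOn_of_dominated (bound := bd R 1) (fun b _ => (cont_h R b).aestronglyMeasurable)
    ?_ (bd_int R _ hR) ?_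
  · intro b hb
    refine (ae_restrict_iff' measurableSet_Ioi).2 (Eventually.of_forall fun t ht => ?_)
    exact h_bd R _ b t (by rw [abs_of_nonneg hb.1]; exact hb.2) ht
  · exact Eventually.of_forall fun t => (cont_h' R t).continuousOn

lemma H_pos (R : ℝ) (hR : 0 < R) (a : ℝ) (ha : 1 ≤ a) : 0 < H R a := by
  have key : ∀ t : ℝ, 0 < t → 0 < h R a t := by
    intro t ht
    unfold h
    have := D_pos_s17 a t
    have h2 : 0 < a - t * (1 - a ^ 2) := by nlinarith [mul_nonneg ht.le (by nlinarith : 0 ≤ a ^ 2 - 1)]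
    positivity
  exact integral_pos' _ (h_int R a hR) (fun t ht => (key t ht).le) (fun t ht => key t ht.1)

lemma H_zero (R : ℝ) (hR : 0 < R) : H R 0 < 0 := by
  have key : ∀ t : ℝ, 0 < t → 0 < - h R 0 t := by
    intro t ht
    unfold h
    have := D_pos_s17 0 t
    have : t * rexp (-(R * t)) * (2 * (0 - t * (1 - 0 ^ 2)) / D 0 t ^ 2)
      = - (t * rexp (-(R * t)) * (2 * t / D 0 t ^ 2)) := by ring
    rw [this, neg_neg]
    positivity
  have := integral_pos' (fun t => - h R 0 t) (h_int R 0 hR).neg (fun t ht => (key t ht).le)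
    (fun t ht => key t ht.1)
  rw [integral_neg] at this
  unfold H
  linarith

/-- rescaled weight -/
noncomputable def w (R a v : ℝ) : ℝ :=
  Real.exp (-(R * (a / (1 - a ^ 2)) * v)) / (D a (a / (1 - a ^ 2) * v)) ^ 2

lemma h_scaled (R a v : ℝ) (ha1 : a ^ 2 < 1) :
    h R a (a / (1 - a ^ 2) * v) = 2 * a * (a / (1 - a ^ 2)) * (v * (1 - v) * w R a v) := by
  unfold h w
  have h1 : 1 - a ^ 2 ≠ 0 := by linarith
  have h2 : a - a / (1 - a ^ 2) * v * (1 - a ^ 2) = a * (1 - v) := by field_simp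
  rw [h2, ← mul_assoc R]
  ring

lemma sq_lt (a : ℝ) (h0 : 0 < a) (h1 : a < 1) : a ^ 2 < 1 := by nlinarith

lemma lam_pos (a : ℝ) (h0 : 0 < a) (h1 : a < 1) : 0 < a / (1 - a ^ 2) :=
  div_pos h0 (by linarith [sq_lt a h0 h1])

lemma j_int (R a : ℝ) (hR : 0 < R) (h0 : 0 < a) (h1 : a < 1) :
    IntegrableOn (fun v => v * (1 - v) * w R a v) (Ioi 0) := by
  have hl := lam_pos a h0 h1
  have := (integrableOn_Ioi_comp_mul_left_iff (h R a) 0 hl).2 (by simpa using h_int R a hR)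
  have h3 := this.const_mul ((2 * a * (a / (1 - a ^ 2)))⁻¹)
  refine IntegrableOn.congr_fun h3 (fun v _ => ?_) measurableSet_Ioi
  rw [h_scaled R a v (sq_lt a h0 h1), ← mul_assoc, inv_mul_cancel₀ (by positivity), one_mul]

lemma H_scaled (R a : ℝ) (h0 : 0 < a) (h1 : a < 1) :
    H R a = 2 * a * (a / (1 - a ^ 2)) ^ 2 * ∫ v in Ioi (0:ℝ), v * (1 - v) * w R a v := by
  have hl := lam_pos a h0 h1
  have := integral_comp_mul_left_Ioi (h R a) 0 hl
  simp_rw [h_scaled R a _ (sq_lt a h0 h1)] at this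
  rw [integral_const_mul, mul_zero, smul_eq_mul] at this
  unfold H
  rw [eq_inv_mul_iff_mul_eq₀ hl.ne'] at this
  rw [← this]; ring

lemma D_scaled (a v : ℝ) (h1 : a ^ 2 < 1) : D a (a / (1 - a ^ 2) * v) =
    1 + 2 * (a ^ 2 / (1 - a ^ 2)) * v
      + (a ^ 2 / (1 - a ^ 2)) * (1 + 2 * (a ^ 2 / (1 - a ^ 2))) * v ^ 2 := by
  unfold D
  have : 1 - a ^ 2 ≠ 0 := by linarith
  field_simp
  ring

lemma poly_cmp (p q v : ℝ) :
    (1 + 2 * q * 1 + q * (1 + 2 * q) * 1 ^ 2) * (1 + 2 * p * v + p * (1 + 2 * p) * v ^ 2)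
    - (1 + 2 * q * v + q * (1 + 2 * q) * v ^ 2) * (1 + 2 * p * 1 + p * (1 + 2 * p) * 1 ^ 2)
    = (1 - v) * ((q - p) * (2 + (1 + 2 * (p + q)) * (1 + v) + 4 * p * q * v)) := by ring

lemma w_pos (R a v : ℝ) : 0 < w R a v := by
  unfold w
  have := D_pos_s17 a (a / (1 - a ^ 2) * v)
  positivity

lemma cross (R a b v : ℝ) (hR : 0 < R) (ha : 0 < a) (hab : a < b) (hb : b < 1) (hv : 0 < v) :
    (v < 1 → w R b 1 * w R a v < w R b v * w R a 1) ∧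
    (1 < v → w R b v * w R a 1 < w R b 1 * w R a v) := by
  have hb0 := ha.trans hab
  have ha2 := sq_lt a ha (hab.trans hb)
  have hb2 := sq_lt b hb0 hb
  have hsq : a ^ 2 < b ^ 2 := by gcongr
  have hp : 0 < a ^ 2 / (1 - a ^ 2) := div_pos (by positivity) (by linarith)
  have hpq : a ^ 2 / (1 - a ^ 2) < b ^ 2 / (1 - b ^ 2) := by
    rw [div_lt_div_iff₀ (by linarith) (by linarith)]; nlinarith
  have hl : a / (1 - a ^ 2) < b / (1 - b ^ 2) := by
    rw [div_lt_div_iff₀ (by linarith) (by linarith)]; nlinarith [mul_pos ha hb0]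
  have A1 := D_pos_s17 a (a / (1 - a ^ 2) * 1)
  have Av := D_pos_s17 a (a / (1 - a ^ 2) * v)
  have B1 := D_pos_s17 b (b / (1 - b ^ 2) * 1)
  have Bv := D_pos_s17 b (b / (1 - b ^ 2) * v)
  have hc := poly_cmp (a ^ 2 / (1 - a ^ 2)) (b ^ 2 / (1 - b ^ 2)) v
  rw [← D_scaled a v ha2, ← D_scaled b v hb2, ← D_scaled a 1 ha2, ← D_scaled b 1 hb2] at hc
  have hpos : 0 < (b ^ 2 / (1 - b ^ 2) - a ^ 2 / (1 - a ^ 2)) *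
      (2 + (1 + 2 * (a ^ 2 / (1 - a ^ 2) + b ^ 2 / (1 - b ^ 2))) * (1 + v)
        + 4 * (a ^ 2 / (1 - a ^ 2)) * (b ^ 2 / (1 - b ^ 2)) * v) := by
    have hq := hp.trans hpq
    refine mul_pos (by linarith) (by positivity)
  unfold w
  generalize D a (a / (1 - a ^ 2) * 1) = dA1 at *
  generalize D a (a / (1 - a ^ 2) * v) = dAv at *
  generalize D b (b / (1 - b ^ 2) * 1) = dB1 at *
  generalize D b (b / (1 - b ^ 2) * v) = dBv at *
  generalize a / (1 - a ^ 2) = l at *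
  generalize b / (1 - b ^ 2) = m at *
  rw [div_mul_div_comm, div_mul_div_comm, ← Real.exp_add, ← Real.exp_add, ← mul_pow, ← mul_pow]
  constructor
  · intro hv1
    refine div_lt_div₀ ?_ ?_ (Real.exp_pos _).le (by positivity)
    · rw [Real.exp_lt_exp]
      nlinarith [mul_pos hR (mul_pos (sub_pos.2 hl) (sub_pos.2 hv1))]
    · have := mul_pos (sub_pos.2 hv1) hpos
      gcongr ?_ ^ 2
      linarith
  · intro hv1
    refine div_lt_div₀ ?_ ?_ (Real.exp_pos _).le (by positivity)
    · rw [Real.exp_lt_exp]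
      nlinarith [mul_pos hR (mul_pos (sub_pos.2 hl) (sub_pos.2 hv1))]
    · have := mul_pos (sub_pos.2 hv1) hpos
      gcongr ?_ ^ 2
      linarith

lemma H_step (R a b : ℝ) (hR : 0 < R) (ha : 0 < a) (hab : a < b) (hb : b < 1) (hH : 0 ≤ H R a) :
    0 < H R b := by
  have hb0 := ha.trans hab
  have ha1 := hab.trans hb
  have la := lam_pos a ha ha1
  have lb := lam_pos b hb0 hb
  rw [H_scaled R a ha ha1] at hH
  rw [H_scaled R b hb0 hb]
  have ia := j_int R a hR ha ha1
  have ib := j_int R b hR hb0 hb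
  have hJ : 0 ≤ ∫ v in Ioi (0:ℝ), v * (1 - v) * w R a v :=
    nonneg_of_mul_nonneg_right hH (by positivity)
  refine mul_pos (by positivity) ?_
  have key := integral_pos' (fun v => w R a 1 * (v * (1 - v) * w R b v)
      - w R b 1 * (v * (1 - v) * w R a v)) ((ib.const_mul _).sub (ia.const_mul _)) ?_ ?_
  · rw [integral_sub (ib.const_mul _) (ia.const_mul _), integral_const_mul,
      integral_const_mul] at key
    have h1 := w_pos R a 1
    have h2 := w_pos R b 1
    have := mul_nonneg h2.le hJ
    exact pos_of_mul_pos_right (by linarith) h1.le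
  · intro v hv
    have hv0 : (0:ℝ) < v := hv
    obtain ⟨c1, c2⟩ := cross R a b v hR ha hab hb hv0
    have e : w R a 1 * (v * (1 - v) * w R b v) - w R b 1 * (v * (1 - v) * w R a v)
      = v * ((1 - v) * (w R b v * w R a 1 - w R b 1 * w R a v)) := by ring
    simp only [e]
    refine mul_nonneg hv0.le ?_
    rcases lt_trichotomy v 1 with hl | hl | hl
    · exact mul_nonneg (by linarith) (by linarith [c1 hl])
    · simp [hl]
    · exact mul_nonneg_of_nonpos_of_nonpos (by linarith) (by linarith [c2 hl])
  · intro v hv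
    obtain ⟨c1, c2⟩ := cross R a b v hR ha hab hb hv.1
    have e : w R a 1 * (v * (1 - v) * w R b v) - w R b 1 * (v * (1 - v) * w R a v)
      = v * ((1 - v) * (w R b v * w R a 1 - w R b 1 * w R a v)) := by ring
    simp only [e]
    exact mul_pos hv.1 (mul_pos (by linarith [hv.2]) (by linarith [c1 hv.2]))

lemma G_shape (R : ℝ) (hR : 0 < R) : ∃ a0 : ℝ, 0 < a0 ∧ StrictAntiOn (G R) (Icc 0 a0) ∧
    StrictMonoOn (G R) (Ici a0) := by
  have h0 := H_zero R hR
  have h1 := H_pos R hR 1 le_rfl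
  obtain ⟨a0, ha, hH⟩ := intermediate_value_Ioo zero_le_one (H_cont R hR) ⟨h0, h1⟩
  have hc : Continuous (G R) := continuous_iff_continuousAt.2 fun a => (G_deriv R hR a).continuousAt
  refine ⟨a0, ha.1, ?_, ?_⟩
  · refine strictAntiOn_of_deriv_neg (convex_Icc _ _) hc.continuousOn ?_
    intro a haa
    rw [interior_Icc] at haa
    rw [(G_deriv R hR a).deriv]
    by_contra hcon
    have := H_step R a a0 hR haa.1 haa.2 ha.2 (not_lt.1 hcon)
    linarith
  · refine strictMonoOn_of_deriv_pos (convex_Ici _) hc.continuousOn ?_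
    intro a haa
    rw [interior_Ici] at haa
    rw [(G_deriv R hR a).deriv]
    rcases lt_or_ge a 1 with h | h
    · exact H_step R a0 a hR ha.1 haa h hH.ge
    · exact H_pos R hR a h

noncomputable def f (R θ u : ℝ) : ℝ :=
  u * Real.exp (-(u * R * Real.sin θ)) / (1 - 2 * u * Real.cos θ + u^2)

noncomputable def A (θ : ℝ) : ℝ := - Real.cos θ / Real.sin θ

lemma g_f (R θ u : ℝ) (hs : 0 < Real.sin θ) :
    g R (A θ) (Real.sin θ * u) = (Real.sin θ)⁻¹ * f R θ u := by
  unfold g f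
  have e1 : 1 + A θ ^ 2 = (Real.sin θ ^ 2)⁻¹ := by
    unfold A
    have := Real.sin_sq_add_cos_sq θ
    field_simp
    linarith
  have e2 : D (A θ) (Real.sin θ * u) = 1 - 2 * u * Real.cos θ + u ^ 2 := by
    unfold D
    rw [e1]
    unfold A
    field_simp
    ring
  rw [e1, e2, show R * (Real.sin θ * u) = u * R * Real.sin θ by ring]
  field_simp

lemma f_int (R θ : ℝ) (hR : 0 < R) (hs : 0 < Real.sin θ) : IntegrableOn (f R θ) (Ioi 0) := by
  have := (integrableOn_Ioi_comp_mul_left_iff (g R (A θ)) 0 hs).2 (by simpa using g_int R _ hR)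
  have h3 := this.const_mul (Real.sin θ)
  refine IntegrableOn.congr_fun h3 (fun v _ => ?_) measurableSet_Ioi
  rw [g_f R θ v hs, ← mul_assoc, mul_inv_cancel₀ hs.ne', one_mul]

lemma Phi_G (R θ : ℝ) (hs : 0 < Real.sin θ) : ∫ u in Ioi (0:ℝ), f R θ u = G R (A θ) := by
  have := integral_comp_mul_left_Ioi (g R (A θ)) 0 hs
  simp_rw [g_f R θ _ hs] at this
  rw [integral_const_mul, mul_zero, smul_eq_mul] at this
  exact mul_left_cancel₀ (inv_pos.2 hs).ne' this

lemma A_mono : StrictMonoOn A (Ioo 0 Real.pi) := by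
  intro x hx y hy hxy
  unfold A
  have sx := Real.sin_pos_of_mem_Ioo hx
  have sy := Real.sin_pos_of_mem_Ioo hy
  rw [div_lt_div_iff₀ sx sy]
  have : 0 < Real.sin (y - x) := Real.sin_pos_of_mem_Ioo ⟨by linarith, by linarith [hx.1, hy.2]⟩
  rw [Real.sin_sub] at this
  linarith

lemma Phi_anti_left (R : ℝ) (hR : 0 < R) :
    StrictAntiOn (fun θ => ∫ u in Ioi (0:ℝ), f R θ u) (Ioc 0 (Real.pi / 2)) := by
  intro x hx y hy hxy
  have hp := Real.pi_pos
  have sx := Real.sin_pos_of_mem_Ioo (x := x) ⟨hx.1, by linarith [hx.2]⟩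
  have sy := Real.sin_pos_of_mem_Ioo (x := y) ⟨hy.1, by linarith [hy.2]⟩
  have hsin : Real.sin x < Real.sin y :=
    Real.sin_lt_sin_of_lt_of_le_pi_div_two (by linarith [hx.1]) hy.2 hxy
  have hcos : Real.cos y < Real.cos x :=
    Real.cos_lt_cos_of_nonneg_of_le_pi_div_two hx.1.le hy.2 hxy
  have key : ∀ u : ℝ, 0 < u → 0 < f R x u - f R y u := by
    intro u hu
    rw [sub_pos]
    unfold f
    have hd : 0 < 1 - 2 * u * Real.cos x + u ^ 2 := by
      nlinarith [Real.sin_sq_add_cos_sq x, sq_nonneg (u - Real.cos x), pow_pos sx 2]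
    refine div_lt_div₀ ?_ ?_ (by positivity) hd
    · gcongr
    · have : 2 * u * Real.cos y ≤ 2 * u * Real.cos x := by gcongr
      linarith
  have := integral_pos' (fun u => f R x u - f R y u) ((f_int R x hR sx).sub (f_int R y hR sy))
    (fun t ht => (key t ht).le) (fun t ht => key t ht.1)
  rw [integral_sub (f_int R x hR sx) (f_int R y hR sy)] at this
  simp only
  linarith

lemma main (R : ℝ) (hR : 0 < R) :
    ∃! θR : ℝ, θR ∈ Set.Ioo 0 Real.pi ∧
      StrictAntiOn (fun θ : ℝ => ∫ u in Set.Ioi (0:ℝ), f R θ u) (Set.Ioc 0 θR) ∧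
      StrictMonoOn (fun θ : ℝ => ∫ u in Set.Ioi (0:ℝ), f R θ u) (Set.Ico θR Real.pi) := by
  have hp := Real.pi_pos
  refine existsUnique_of_exists_of_unique ?_ ?_
  · obtain ⟨a0, ha0, hanti, hmono⟩ := G_shape R hR
    -- the angle
    set T := Real.pi / 2 + Real.arctan a0 with hT
    have t0 : 0 < Real.arctan a0 := Real.arctan_pos.2 ha0
    have t1 := Real.arctan_lt_pi_div_two a0
    have hTm : T ∈ Ioo 0 Real.pi := ⟨by linarith, by linarith⟩
    have hAT : A T = a0 := by
      unfold A
      rw [hT, add_comm, Real.cos_add_pi_div_two, Real.sin_add_pi_div_two, neg_neg,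
        ← Real.tan_eq_sin_div_cos, Real.tan_arctan]
    have hA0 : A (Real.pi / 2) = 0 := by simp [A]
    have hmem : Real.pi / 2 ∈ Ioo 0 Real.pi := ⟨by linarith, by linarith⟩
    refine ⟨T, hTm, ?_, ?_⟩
    · have hr : StrictAntiOn (fun θ : ℝ => ∫ u in Set.Ioi (0:ℝ), f R θ u)
          (Icc (Real.pi / 2) T) := by
        intro x hx y hy hxy
        have mx : x ∈ Ioo 0 Real.pi := ⟨by linarith [hx.1], by linarith [hx.2, hTm.2]⟩
        have my : y ∈ Ioo 0 Real.pi := ⟨by linarith [hy.1], by linarith [hy.2, hTm.2]⟩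
        simp only
        rw [Phi_G R x (Real.sin_pos_of_mem_Ioo mx), Phi_G R y (Real.sin_pos_of_mem_Ioo my)]
        refine hanti ⟨?_, ?_⟩ ⟨?_, ?_⟩ (A_mono mx my hxy)
        · rw [← hA0]; exact A_mono.monotoneOn hmem mx hx.1
        · rw [← hAT]; exact A_mono.monotoneOn mx hTm hx.2
        · rw [← hA0]; exact A_mono.monotoneOn hmem my hy.1
        · rw [← hAT]; exact A_mono.monotoneOn my hTm hy.2
      have hle : Real.pi / 2 ≤ T := by linarith
      have := (Phi_anti_left R hR).union hr (c := Real.pi / 2)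
        ⟨⟨by linarith, le_rfl⟩, fun z hz => hz.2⟩ ⟨⟨le_rfl, hle⟩, fun z hz => hz.1⟩
      rwa [Ioc_union_Icc_eq_Ioc (by linarith) hle] at this
    · intro x hx y hy hxy
      have mx : x ∈ Ioo 0 Real.pi := ⟨by linarith [hx.1, hTm.1], hx.2⟩
      have my : y ∈ Ioo 0 Real.pi := ⟨by linarith [hy.1, hTm.1], hy.2⟩
      simp only
      rw [Phi_G R x (Real.sin_pos_of_mem_Ioo mx), Phi_G R y (Real.sin_pos_of_mem_Ioo my)]
      refine hmono ?_ ?_ (A_mono mx my hxy)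
      · rw [mem_Ici, ← hAT]; exact A_mono.monotoneOn hTm mx hx.1
      · rw [mem_Ici, ← hAT]; exact A_mono.monotoneOn hTm my hy.1
  · have aux : ∀ x y : ℝ, x ∈ Ioo 0 Real.pi → y ∈ Ioo 0 Real.pi →
        StrictMonoOn (fun θ : ℝ => ∫ u in Set.Ioi (0:ℝ), f R θ u) (Set.Ico x Real.pi) →
        StrictAntiOn (fun θ : ℝ => ∫ u in Set.Ioi (0:ℝ), f R θ u) (Set.Ioc 0 y) → ¬ x < y := by
      intro x y hx hy hm ha hxy
      have h1 := hm ⟨le_rfl, hx.2⟩ ⟨hxy.le, hy.2⟩ hxy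
      have h2 := ha ⟨hx.1, hxy.le⟩ ⟨hy.1, le_rfl⟩ hxy
      exact lt_asymm h1 h2
    rintro x y ⟨hx, hxa, hxm⟩ ⟨hy, hya, hym⟩
    exact le_antisymm (not_lt.1 (aux y x hy hx hym hxa)) (not_lt.1 (aux x y hx hy hxm hya))

end FreeGamma

/-- for each `R > 0` the function
`Φ_R(θ) = ∫₀^∞ u e^{-uR sin θ}/(1 − 2u cos θ + u²) du` on `(0, π)` is strictly
decreasing up to a unique `θ_R` and strictly increasing afterwards. -/
theorem free_gamma_Phi_unique_minimum (R : ℝ) (hR : 0 < R) :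
    ∃! θR : ℝ, θR ∈ Set.Ioo 0 Real.pi ∧
      StrictAntiOn
        (fun θ : ℝ => ∫ u in Set.Ioi (0:ℝ),
          u * Real.exp (-(u * R * Real.sin θ)) / (1 - 2 * u * Real.cos θ + u^2))
        (Set.Ioc 0 θR) ∧
      StrictMonoOn
        (fun θ : ℝ => ∫ u in Set.Ioi (0:ℝ),
          u * Real.exp (-(u * R * Real.sin θ)) / (1 - 2 * u * Real.cos θ + u^2))
        (Set.Ico θR Real.pi) := by
  exact FreeGamma.main R hR
end

section
/- Let α > 0. There exists ω_α ∈ (s_α, ∞) such that f_α is strictly increasing on [s_α, ω_α] and strictly decreasing on [ω_α, ∞); in particular the density f_α of the free Gamma distribution is unimodal. -/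
open MeasureTheory Set Filter

lemma fg_int_lt {g h : ℝ → ℝ} (hg : IntegrableOn g (Ioi 0)) (hh : IntegrableOn h (Ioi 0))
    (hlt : ∀ t, 0 < t → g t < h t) : ∫ t in Ioi (0:ℝ), g t < ∫ t in Ioi (0:ℝ), h t := by
  have h1 : 0 < ∫ t in Ioi (0:ℝ), (h t - g t) := by
    rw [setIntegral_pos_iff_support_of_nonneg_ae]
    · have : Ioi (0:ℝ) ⊆ (Function.support fun t => h t - g t) ∩ Ioi 0 := by
        intro t ht
        exact ⟨(sub_pos.2 (hlt t ht)).ne', ht⟩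
      refine lt_of_lt_of_le ?_ (measure_mono this)
      simp
    · filter_upwards [ae_restrict_mem measurableSet_Ioi] with t ht
      exact (sub_pos.2 (hlt t ht)).le
    · exact hh.sub hg
  rw [integral_sub hh hg] at h1
  linarith

lemma fg_ker_int {b : ℝ} (hb : 0 < b) :
    IntegrableOn (fun t : ℝ => t * Real.exp (-(b * t))) (Ioi 0) := by
  have := integrableOn_rpow_mul_exp_neg_mul_rpow (s := 1) (p := 1) (b := b) (by norm_num) (by norm_num) hb
  simpa using this

lemma fg_int_of_bound {b m : ℝ} (hb : 0 < b) (hm : 0 < m) (D : ℝ → ℝ) (hD : Measurable D)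
    (h : ∀ t, 0 < t → m ≤ D t) :
    IntegrableOn (fun t : ℝ => t * Real.exp (-(b * t)) / D t) (Ioi 0) := by
  refine Integrable.mono' ((fg_ker_int hb).const_mul m⁻¹) ?_ ?_
  · exact Measurable.aestronglyMeasurable (by fun_prop)
  · filter_upwards [ae_restrict_mem measurableSet_Ioi] with t ht
    have ht : 0 < t := ht
    have := h t ht
    have hp : 0 < t * Real.exp (-(b * t)) := by positivity
    rw [Real.norm_of_nonneg (div_nonneg hp.le (hm.le.trans this)), div_eq_inv_mul]
    gcongr

/-- polar form -/
noncomputable def fgJ (r k : ℝ) : ℝ :=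
  ∫ u in Ioi (0:ℝ), u * Real.exp (-(r * u)) / (1 - 2 * u * k + u ^ 2)

lemma fgD_ge (k u : ℝ) : 1 - k ^ 2 ≤ 1 - 2 * u * k + u ^ 2 := by nlinarith [sq_nonneg (u - k)]

lemma fg_one_sub {k : ℝ} (h1 : -1 < k) (h2 : k < 1) : 0 < 1 - k ^ 2 := by nlinarith

lemma fgJ_int {r k : ℝ} (hr : 0 < r) (h1 : -1 < k) (h2 : k < 1) :
    IntegrableOn (fun u : ℝ => u * Real.exp (-(r * u)) / (1 - 2 * u * k + u ^ 2)) (Ioi 0) :=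
  fg_int_of_bound hr (fg_one_sub h1 h2) _ (by fun_prop) (fun t _ => fgD_ge k t)

lemma fgJ_anti {r r' k : ℝ} (hr : 0 < r) (hrr : r < r') (h1 : -1 < k) (h2 : k < 1) :
    fgJ r' k < fgJ r k := by
  refine fg_int_lt (fgJ_int (hr.trans hrr) h1 h2) (fgJ_int hr h1 h2) fun u hu => ?_
  have := (fg_one_sub h1 h2).trans_le (fgD_ge k u)
  gcongr

lemma fgJ_mono {r k k' : ℝ} (hr : 0 < r) (hk : k < k') (h1 : -1 < k) (h2 : k' < 1) :
    fgJ r k < fgJ r k' := by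
  refine fg_int_lt (fgJ_int hr h1 (hk.trans h2)) (fgJ_int hr (h1.trans hk) h2) fun u hu => ?_
  have := (fg_one_sub (h1.trans hk) h2).trans_le (fgD_ge k' u)
  gcongr

lemma fg_polar {r k x y : ℝ} (hr : 0 < r) (hx : x = r * k) (hy : x ^ 2 + y ^ 2 = r ^ 2) :
    Fint x y = fgJ r k := by
  have h := integral_comp_mul_left_Ioi
    (fun t : ℝ => t * Real.exp (-t) / ((x - t)^2 + y^2)) 0 hr
  rw [mul_zero] at h
  have h2 : Fint x y = r * ∫ u in Ioi (0:ℝ),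
      (r * u) * Real.exp (-(r * u)) / ((x - (r * u))^2 + y^2) := by
    rw [h, Fint, smul_eq_mul]; field_simp
  rw [h2, fgJ, ← integral_const_mul]
  congr 1; ext u
  have : (x - (r * u))^2 + y^2 = r ^ 2 * (1 - 2 * u * k + u ^ 2) := by
    have : y ^ 2 = r ^ 2 - x ^ 2 := by linarith
    rw [this, hx]; ring
  rw [this]
  field_simp

lemma fgG_convex {R a b p q : ℝ} (hR : 0 < R) (ha : 0 < a) (hb : 0 < b) (hab : a + b = 1)
    (hp : Real.pi / 2 ≤ p) (hpq : p < q) (hq : q < Real.pi) :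
    fgJ (R * Real.sin (a * p + b * q)) (Real.cos (a * p + b * q)) <
      a * fgJ (R * Real.sin p) (Real.cos p) + b * fgJ (R * Real.sin q) (Real.cos q) := by
  have hpi := Real.pi_pos
  have hm1 : p < a * p + b * q := by nlinarith
  have hm2 : a * p + b * q < q := by nlinarith
  have hS : ∀ θ, Real.pi / 2 ≤ θ → θ < Real.pi → 0 < Real.sin θ := fun θ h1 h2 =>
    Real.sin_pos_of_pos_of_lt_pi (by linarith) h2
  have hC1 : ∀ θ, Real.pi / 2 ≤ θ → θ < Real.pi → -1 < Real.cos θ := fun θ h1 h2 => by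
    nlinarith [hS θ h1 h2, Real.sin_sq_add_cos_sq θ, Real.neg_one_le_cos θ]
  have hC2 : ∀ θ, Real.pi / 2 ≤ θ → θ < Real.pi → Real.cos θ < 1 := fun θ h1 h2 => by
    nlinarith [hS θ h1 h2, Real.sin_sq_add_cos_sq θ, Real.cos_le_one θ]
  have hI : ∀ θ, Real.pi / 2 ≤ θ → θ < Real.pi → _ := fun θ h1 h2 =>
    fgJ_int (r := R * Real.sin θ) (k := Real.cos θ) (mul_pos hR (hS θ h1 h2)) (hC1 θ h1 h2) (hC2 θ h1 h2)
  have hIp := hI p hp (by linarith)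
  have hIq := hI q (by linarith) hq
  have hIm := hI (a * p + b * q) (by linarith) (by linarith)
  have hsin := strictConcaveOn_sin_Icc.2 (x := p) ⟨by linarith, by linarith⟩ (y := q)
    ⟨by linarith, by linarith⟩ hpq.ne ha hb hab
  have hcos := strictConcaveOn_cos_Icc.2 (x := Real.pi - p) ⟨by linarith, by linarith⟩
    (y := Real.pi - q) ⟨by linarith, by linarith⟩ (by intro h; linarith) ha hb hab
  simp only [smul_eq_mul] at hsin hcos
  have e : a * (Real.pi - p) + b * (Real.pi - q) = Real.pi - (a * p + b * q) := by
    linear_combination Real.pi * hab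
  rw [e, Real.cos_pi_sub, Real.cos_pi_sub, Real.cos_pi_sub] at hcos
  rw [fgJ, fgJ, fgJ, ← integral_const_mul, ← integral_const_mul,
    ← integral_add (hIp.const_mul a) (hIq.const_mul b)]
  refine fg_int_lt hIm ((hIp.const_mul a).add (hIq.const_mul b)) fun u hu => ?_
  have hDpos : ∀ θ, Real.pi / 2 ≤ θ → θ < Real.pi → 0 < 1 - 2 * u * Real.cos θ + u ^ 2 :=
    fun θ h1 h2 => (fg_one_sub (hC1 θ h1 h2) (hC2 θ h1 h2)).trans_le (fgD_ge _ _)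
  have hDp := hDpos p hp (by linarith)
  have hDq := hDpos q (by linarith) hq
  have hDm := hDpos (a * p + b * q) (by linarith) (by linarith)
  generalize Real.cos (a * p + b * q) = cm at *
  generalize Real.sin (a * p + b * q) = sm at *
  generalize Real.cos p = cp at *
  generalize Real.cos q = cq at *
  generalize Real.sin p = sp at *
  generalize Real.sin q = sq at *
  have key : ∀ s k, 0 < 1 - 2 * u * k + u ^ 2 → u * Real.exp (-(R * s * u)) / (1 - 2 * u * k + u ^ 2)
      = u * Real.exp (-(R * s * u) - Real.log (1 - 2 * u * k + u ^ 2)) := by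
    intro s k h
    rw [Real.exp_sub, Real.exp_log h]; ring
  show u * Real.exp (-(R * sm * u)) / (1 - 2 * u * cm + u ^ 2) <
    a * (u * Real.exp (-(R * sp * u)) / (1 - 2 * u * cp + u ^ 2)) +
    b * (u * Real.exp (-(R * sq * u)) / (1 - 2 * u * cq + u ^ 2))
  rw [key _ _ hDp, key _ _ hDq, key _ _ hDm]
  have hlog := strictConcaveOn_log_Ioi.concaveOn.2 (x := 1 - 2 * u * cp + u ^ 2) hDp
    (y := 1 - 2 * u * cq + u ^ 2) hDq ha.le hb.le hab
  simp only [smul_eq_mul] at hlog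
  have hlog2 : Real.log (a * (1 - 2 * u * cp + u ^ 2) + b * (1 - 2 * u * cq + u ^ 2)) ≤
      Real.log (1 - 2 * u * cm + u ^ 2) := by
    apply Real.log_le_log (by positivity)
    have : u * cm ≤ u * (a * cp + b * cq) := by
      apply mul_le_mul_of_nonneg_left _ hu.le; linarith
    have h3 : a * (1 - 2 * u * cp + u ^ 2) + b * (1 - 2 * u * cq + u ^ 2) =
      1 - 2 * (u * (a * cp + b * cq)) + u ^ 2 := by linear_combination (1 + u ^ 2) * hab
    linarith
  have hs : R * u * (a * sp + b * sq) < R * u * sm :=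
    mul_lt_mul_of_pos_left hsin (mul_pos hR hu)
  have hexp := convexOn_exp.2 (x := -(R * sp * u) - Real.log (1 - 2 * u * cp + u ^ 2)) (mem_univ _)
    (y := -(R * sq * u) - Real.log (1 - 2 * u * cq + u ^ 2)) (mem_univ _) ha.le hb.le hab
  simp only [smul_eq_mul] at hexp
  have hlt : Real.exp (-(R * sm * u) - Real.log (1 - 2 * u * cm + u ^ 2)) <
     Real.exp (a * (-(R * sp * u) - Real.log (1 - 2 * u * cp + u ^ 2)) +
       b * (-(R * sq * u) - Real.log (1 - 2 * u * cq + u ^ 2))) := by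
    apply Real.exp_lt_exp.2
    nlinarith
  have := mul_lt_mul_of_pos_left (hlt.trans_le hexp) hu
  linarith

lemma fg_sin_pos {θ : ℝ} (h1 : 0 < θ) (h2 : θ < Real.pi) : 0 < Real.sin θ :=
  Real.sin_pos_of_pos_of_lt_pi h1 h2

lemma fg_cos_gt {θ : ℝ} (h1 : 0 < θ) (h2 : θ < Real.pi) : -1 < Real.cos θ := by
  nlinarith [fg_sin_pos h1 h2, Real.sin_sq_add_cos_sq θ, Real.neg_one_le_cos θ]

lemma fg_cos_lt {θ : ℝ} (h1 : 0 < θ) (h2 : θ < Real.pi) : Real.cos θ < 1 := by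
  nlinarith [fg_sin_pos h1 h2, Real.sin_sq_add_cos_sq θ, Real.cos_le_one θ]

lemma fgG_anti {R p q : ℝ} (hR : 0 < R) (hp : 0 < p) (hpq : p < q) (hq : q ≤ Real.pi / 2) :
    fgJ (R * Real.sin q) (Real.cos q) < fgJ (R * Real.sin p) (Real.cos p) := by
  have hpi := Real.pi_pos
  have hs : Real.sin p < Real.sin q :=
    Real.sin_lt_sin_of_lt_of_le_pi_div_two (by linarith) hq hpq
  have hcc : Real.cos q < Real.cos p :=
    Real.cos_lt_cos_of_nonneg_of_le_pi hp.le (by linarith) hpq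
  have hsp := fg_sin_pos hp (by linarith)
  calc _ < fgJ (R * Real.sin p) (Real.cos q) :=
        fgJ_anti (mul_pos hR hsp) (mul_lt_mul_of_pos_left hs hR)
          (fg_cos_gt (by linarith) (by linarith)) (fg_cos_lt (by linarith) (by linarith))
    _ < _ := fgJ_mono (mul_pos hR hsp) hcc (fg_cos_gt (by linarith) (by linarith))
          (fg_cos_lt (by linarith) (by linarith))

lemma fgG_convex' {R p m q : ℝ} (hR : 0 < R) (hp : Real.pi / 2 ≤ p) (hpm : p < m) (hmq : m < q)
    (hq : q < Real.pi) :
    fgJ (R * Real.sin m) (Real.cos m) <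
      max (fgJ (R * Real.sin p) (Real.cos p)) (fgJ (R * Real.sin q) (Real.cos q)) := by
  have hqp : 0 < q - p := by linarith
  have h := fgG_convex (R := R) (a := (q - m) / (q - p)) (b := (m - p) / (q - p)) (p := p) (q := q) hR
    (div_pos (by linarith) hqp) (div_pos (by linarith) hqp) (by field_simp; ring) hp (by linarith) hq
  have e : (q - m) / (q - p) * p + (m - p) / (q - p) * q = m := by field_simp; ring
  rw [e] at h
  refine h.trans_le ?_
  set A := fgJ (R * Real.sin p) (Real.cos p)
  set B := fgJ (R * Real.sin q) (Real.cos q)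
  have h1 : (q - m) / (q - p) * A ≤ (q - m) / (q - p) * max A B :=
    mul_le_mul_of_nonneg_left (le_max_left _ _) (div_pos (by linarith) hqp).le
  have h2 : (m - p) / (q - p) * B ≤ (m - p) / (q - p) * max A B :=
    mul_le_mul_of_nonneg_left (le_max_right _ _) (div_pos (by linarith) hqp).le
  have h3 : (q - m) / (q - p) * max A B + (m - p) / (q - p) * max A B = max A B := by
    field_simp; ring
  linarith

lemma fgG_quasi {R p m q : ℝ} (hR : 0 < R) (hp : 0 < p) (hpm : p < m) (hmq : m < q)
    (hq : q < Real.pi) :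
    fgJ (R * Real.sin m) (Real.cos m) <
      max (fgJ (R * Real.sin p) (Real.cos p)) (fgJ (R * Real.sin q) (Real.cos q)) := by
  rcases le_or_gt m (Real.pi / 2) with hm | hm
  · exact lt_max_of_lt_left (fgG_anti hR hp hpm hm)
  · rcases le_or_gt (Real.pi / 2) p with h | h
    · exact fgG_convex' hR h hpm hmq hq
    · refine (fgG_convex' hR le_rfl hm hmq hq).trans_le ?_
      exact max_le_max (fgG_anti hR hp h le_rfl).le le_rfl

lemma fgF_int {x y : ℝ} (h : x < 0 ∨ y ≠ 0) :
    IntegrableOn (fun t : ℝ => t * Real.exp (-t) / ((x - t)^2 + y^2)) (Ioi 0) := by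
  have key : ∃ m : ℝ, 0 < m ∧ ∀ t, 0 < t → m ≤ (x - t)^2 + y^2 := by
    rcases h with h | h
    · exact ⟨x ^ 2, by have := h.ne; positivity, fun t ht => by nlinarith [sq_nonneg y]⟩
    · exact ⟨y ^ 2, by positivity, fun t ht => by nlinarith [sq_nonneg (x - t)]⟩
  obtain ⟨m, hm, hm2⟩ := key
  simpa using fg_int_of_bound one_pos hm (fun t => (x - t)^2 + y^2) (by fun_prop) hm2

lemma fgN_pos {x y t : ℝ} (h : x < 0 ∨ y ≠ 0) (ht : 0 < t) : 0 < (x - t)^2 + y^2 := by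
  rcases h with h | h
  · nlinarith [sq_nonneg y]
  · have : 0 < y ^ 2 := by positivity
    nlinarith [sq_nonneg (x - t)]

lemma fgF_lt {x y x' y' : ℝ} (h : x < 0 ∨ y ≠ 0) (h' : x' < 0 ∨ y' ≠ 0)
    (hlt : ∀ t, 0 < t → (x' - t)^2 + y'^2 < (x - t)^2 + y^2) : Fint x y < Fint x' y' := by
  refine fg_int_lt (fgF_int h) (fgF_int h') fun t ht => ?_
  have := fgN_pos h' ht
  exact div_lt_div_of_pos_left (by positivity) this (hlt t ht)

lemma fg_normsq (x y t : ℝ) : ‖((x:ℂ) + (y:ℂ) * Complex.I) - (t:ℂ)‖ ^ 2 = (x - t)^2 + y^2 := by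
  rw [Complex.sq_norm, Complex.normSq_apply]
  simp; ring

lemma fg_cint {x y : ℝ} (h : x < 0 ∨ y ≠ 0) :
    IntegrableOn (fun t : ℝ => ((t * Real.exp (-t) : ℝ) : ℂ) / (((x:ℂ) + (y:ℂ) * Complex.I) - (t:ℂ)))
      (Ioi 0) := by
  have hk := fg_ker_int one_pos
  simp only [one_mul] at hk
  refine Integrable.mono' (hk.add (fgF_int h)) ?_ ?_
  · exact Measurable.aestronglyMeasurable (by fun_prop)
  · filter_upwards [ae_restrict_mem measurableSet_Ioi] with t ht
    have ht : 0 < t := ht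
    have hN := fgN_pos h ht
    rw [← fg_normsq] at hN
    have hkp : 0 < t * Real.exp (-t) := by positivity
    simp only [Pi.add_apply]
    rw [norm_div, Complex.norm_real, Real.norm_of_nonneg hkp.le, ← fg_normsq]
    have hn : 0 < ‖((x:ℂ) + (y:ℂ) * Complex.I) - (t:ℂ)‖ := by
      by_contra h0
      have : ‖((x:ℂ) + (y:ℂ) * Complex.I) - (t:ℂ)‖ = 0 := le_antisymm (not_lt.1 h0) (norm_nonneg _)
      rw [this] at hN; norm_num at hN
    set n := ‖((x:ℂ) + (y:ℂ) * Complex.I) - (t:ℂ)‖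
    set k := t * Real.exp (-t)
    have e : k + k / n ^ 2 - k / n = k * ((1 / n - 1 / 2) ^ 2 + 3 / 4) := by field_simp; ring
    have : 0 ≤ k * ((1 / n - 1 / 2) ^ 2 + 3 / 4) := by positivity
    linarith

lemma fgH_diff {α x₁ y₁ x₂ y₂ p₁ p₂ : ℝ} (hα : 0 < α) (h₁ : x₁ < 0 ∨ y₁ ≠ 0) (h₂ : x₂ < 0 ∨ y₂ ≠ 0)
    (hF₁ : Fint x₁ y₁ ≤ 1 / α) (hF₂ : Fint x₂ y₂ ≤ 1 / α) (hx : x₁ < x₂)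
    (hp₁ : (p₁ : ℂ) = Hfun α ((x₁ : ℂ) + (y₁ : ℂ) * Complex.I))
    (hp₂ : (p₂ : ℂ) = Hfun α ((x₂ : ℂ) + (y₂ : ℂ) * Complex.I)) : p₁ ≤ p₂ := by
  set z₁ := (x₁ : ℂ) + (y₁ : ℂ) * Complex.I with hz₁
  set z₂ := (x₂ : ℂ) + (y₂ : ℂ) * Complex.I with hz₂
  set w : ℂ := ∫ t in Ioi (0:ℝ), ((t * Real.exp (-t) : ℝ) : ℂ) / ((z₁ - (t:ℂ)) * (z₂ - (t:ℂ))) with hw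
  have hne : ∀ {x y t : ℝ}, (x < 0 ∨ y ≠ 0) → 0 < t → (x : ℂ) + (y : ℂ) * Complex.I - (t:ℂ) ≠ 0 := by
    intro x y t h ht h0
    have := fgN_pos h ht
    rw [← fg_normsq, h0] at this
    norm_num at this
  have e : (p₂ : ℂ) - p₁ = (z₂ - z₁) * (1 - α * w) := by
    have hd : (∫ t in Ioi (0:ℝ), ((t * Real.exp (-t) : ℝ) : ℂ) / (z₂ - (t:ℂ))) -
        (∫ t in Ioi (0:ℝ), ((t * Real.exp (-t) : ℝ) : ℂ) / (z₁ - (t:ℂ))) = -(z₂ - z₁) * w := by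
      rw [← integral_sub (fg_cint h₂) (fg_cint h₁), hw, ← integral_const_mul]
      refine setIntegral_congr_fun measurableSet_Ioi fun t ht => ?_
      have n1 : z₁ - (t:ℂ) ≠ 0 := hne h₁ ht
      have n2 : z₂ - (t:ℂ) ≠ 0 := hne h₂ ht
      rw [← hz₁, ← hz₂]
      field_simp
      ring
    rw [hp₁, hp₂, Hfun, Hfun]
    linear_combination (α : ℂ) * hd
  have hwn : ‖w‖ ≤ 1 / α := by
    have : ‖w‖ ≤ ∫ t in Ioi (0:ℝ), (1/2 : ℝ) * (t * Real.exp (-t) / ((x₁ - t)^2 + y₁^2) +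
        t * Real.exp (-t) / ((x₂ - t)^2 + y₂^2)) := by
      refine norm_integral_le_of_norm_le (((fgF_int h₁).add (fgF_int h₂)).const_mul _) ?_
      filter_upwards [ae_restrict_mem measurableSet_Ioi] with t ht
      have ht : 0 < t := ht
      have hkp : 0 < t * Real.exp (-t) := by positivity
      rw [norm_div, norm_mul, Complex.norm_real, Real.norm_of_nonneg hkp.le, ← fg_normsq, ← fg_normsq]
      have n1 : 0 < ‖z₁ - (t:ℂ)‖ := norm_pos_iff.2 (hne h₁ ht)
      have n2 : 0 < ‖z₂ - (t:ℂ)‖ := norm_pos_iff.2 (hne h₂ ht)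
      rw [← hz₁, ← hz₂]
      generalize ‖z₁ - (t:ℂ)‖ = a at *
      generalize ‖z₂ - (t:ℂ)‖ = b at *
      generalize t * Real.exp (-t) = k at *
      have e : 1 / 2 * (k / a ^ 2 + k / b ^ 2) - k / (a * b) = k / 2 * (1 / a - 1 / b) ^ 2 := by
        field_simp; ring
      have : 0 ≤ k / 2 * (1 / a - 1 / b) ^ 2 := by positivity
      linarith
    rw [integral_const_mul, integral_add (fgF_int h₁) (fgF_int h₂)] at this
    simp only [Fint] at hF₁ hF₂
    linarith
  have hre : w.re ≤ 1 / α := (Complex.re_le_norm w).trans hwn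
  have e2 : ((p₂ : ℂ) - p₁) * (starRingEnd ℂ) (z₂ - z₁) = (Complex.normSq (z₂ - z₁) : ℂ) * (1 - α * w) := by
    rw [e, Complex.normSq_eq_conj_mul_self]; ring
  have e3 := congrArg Complex.re e2
  rw [← Complex.ofReal_sub, Complex.re_ofReal_mul, Complex.re_ofReal_mul] at e3
  have e4 : ((starRingEnd ℂ) (z₂ - z₁)).re = x₂ - x₁ := by simp [hz₁, hz₂]
  have e5 : ((1:ℂ) - α * w).re = 1 - α * w.re := by simp
  rw [e4, e5] at e3
  have h6 : α * w.re ≤ 1 := by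
    have := mul_le_mul_of_nonneg_left hre hα.le
    rwa [mul_one_div_cancel hα.ne'] at this
  have h7 : 0 ≤ (p₂ - p₁) * (x₂ - x₁) := by
    rw [e3]; exact mul_nonneg (Complex.normSq_nonneg _) (by linarith)
  have := nonneg_of_mul_nonneg_left h7 (by linarith)
  linarith

lemma fgF_cont {m : ℝ} (hm : 0 < m) :
    ContinuousOn (fun p : ℝ × ℝ => Fint p.1 p.2) {p | m ≤ p.2} := by
  have hk := (fg_ker_int one_pos).const_mul (m ^ 2)⁻¹
  simp only [one_mul] at hk
  unfold Fint
  refine continuousOn_of_dominated (bound := fun t => (m ^ 2)⁻¹ * (t * Real.exp (-t))) ?_ ?_ hk ?_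
  · intro p hp
    exact Measurable.aestronglyMeasurable (by fun_prop)
  · intro p hp
    have hp : m ≤ p.2 := hp
    filter_upwards [ae_restrict_mem measurableSet_Ioi] with t ht
    have ht : 0 < t := ht
    have hkp : 0 < t * Real.exp (-t) := by positivity
    have h1 : m ^ 2 ≤ (p.1 - t)^2 + p.2^2 := by nlinarith [sq_nonneg (p.1 - t)]
    rw [Real.norm_of_nonneg (by positivity), div_eq_inv_mul]
    gcongr
  · filter_upwards [ae_restrict_mem measurableSet_Ioi] with t ht
    refine ContinuousOn.div (by fun_prop) (by fun_prop) fun p hp => ?_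
    have hp : m ≤ p.2 := hp
    have : 0 < p.2 := by linarith
    positivity

lemma fg_point {x y : ℝ} (hy : 0 < y) : ∃ r θ : ℝ, 0 < r ∧ 0 < θ ∧ θ < Real.pi ∧
    x = r * Real.cos θ ∧ y = r * Real.sin θ ∧ x ^ 2 + y ^ 2 = r ^ 2 := by
  have hr : 0 < x ^ 2 + y ^ 2 := by positivity
  have hr' := Real.sqrt_pos.2 hr
  have hsq := Real.sq_sqrt hr.le
  set r := Real.sqrt (x ^ 2 + y ^ 2)
  have h1 : -1 < x / r := by rw [lt_div_iff₀ hr']; nlinarith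
  have h2 : x / r < 1 := by rw [div_lt_iff₀ hr']; nlinarith
  have hc := Real.cos_arccos h1.le h2.le
  have hθ0 : 0 < Real.arccos (x / r) := Real.arccos_pos.2 h2
  have hθ1 : Real.arccos (x / r) < Real.pi := by
    refine lt_of_le_of_ne (Real.arccos_le_pi _) fun h => ?_
    rw [h, Real.cos_pi] at hc; linarith
  have hs := fg_sin_pos hθ0 hθ1
  have hx : x = r * Real.cos (Real.arccos (x / r)) := by rw [hc]; field_simp
  refine ⟨r, Real.arccos (x / r), hr', hθ0, hθ1, hx, ?_, hsq.symm⟩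
  have h3 := Real.sin_sq_add_cos_sq (Real.arccos (x / r))
  rw [hc] at h3
  set sn := Real.sin (Real.arccos (x / r))
  have : y ^ 2 = (r * sn) ^ 2 := by
    have : sn ^ 2 = 1 - (x / r) ^ 2 := by linarith
    rw [mul_pow, this]; field_simp; linarith
  exact (pow_left_inj₀ hy.le (by positivity) two_ne_zero).1 this

lemma fg_angle {x₁ y₁ x₂ y₂ r₁ r₂ θ₁ θ₂ : ℝ} (hy₁ : 0 < y₁) (hy₂ : 0 < y₂) (hr₁ : 0 < r₁) (hr₂ : 0 < r₂)
    (hθ₁ : 0 < θ₁) (hθ₁' : θ₁ < Real.pi) (hθ₂ : 0 < θ₂) (hθ₂' : θ₂ < Real.pi)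
    (ex₁ : x₁ = r₁ * Real.cos θ₁) (ex₂ : x₂ = r₂ * Real.cos θ₂)
    (es₁ : x₁ ^ 2 + y₁ ^ 2 = r₁ ^ 2) (es₂ : x₂ ^ 2 + y₂ ^ 2 = r₂ ^ 2)
    (hF : Fint x₁ y₁ = Fint x₂ y₂) (hx : x₁ < x₂) : θ₂ < θ₁ := by
  by_contra hcon
  have hk : Real.cos θ₂ ≤ Real.cos θ₁ :=
    Real.cos_le_cos_of_nonneg_of_le_pi hθ₁.le hθ₂'.le (not_lt.1 hcon)
  have a1 := fg_cos_gt hθ₁ hθ₁'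
  have a2 := fg_cos_lt hθ₁ hθ₁'
  have b1 := fg_cos_gt hθ₂ hθ₂'
  have b2 := fg_cos_lt hθ₂ hθ₂'
  have hF' := hF
  rw [fg_polar hr₁ ex₁ es₁, fg_polar hr₂ ex₂ es₂] at hF'
  generalize Real.cos θ₁ = k₁ at *
  generalize Real.cos θ₂ = k₂ at *
  rcases le_or_gt 0 k₁ with h | h
  · have hrr : r₂ ≤ r₁ := by
      by_contra hlt
      have h1 := fgJ_anti hr₁ (not_le.1 hlt) a1 a2
      have h2 : fgJ r₂ k₂ ≤ fgJ r₂ k₁ := by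
        rcases hk.eq_or_lt with h | h
        · rw [h]
        · exact (fgJ_mono hr₂ h b1 a2).le
      linarith
    have : r₂ * k₂ ≤ r₂ * k₁ := mul_le_mul_of_nonneg_left hk hr₂.le
    have : r₂ * k₁ ≤ r₁ * k₁ := mul_le_mul_of_nonneg_right hrr h
    linarith
  · have hx2 : x₂ < 0 := by rw [ex₂]; exact mul_neg_of_pos_of_neg hr₂ (by linarith)
    have hx1 : x₁ < 0 := by linarith
    have hyy : y₁ < y₂ := by
      by_contra hle
      have := fgF_lt (Or.inl hx1) (Or.inl hx2) (y := y₁) (y' := y₂) fun t ht => by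
        nlinarith [not_lt.1 hle]
      linarith
    have h1 : y₁ ^ 2 < y₂ ^ 2 := by nlinarith
    have h2 : x₂ ^ 2 < x₁ ^ 2 := by nlinarith
    have h3 : k₁ ^ 2 ≤ k₂ ^ 2 := by nlinarith
    have h4 : x₂ ^ 2 * y₁ ^ 2 < x₁ ^ 2 * y₂ ^ 2 := by
      have : 0 < y₁ ^ 2 := by positivity
      nlinarith [sq_nonneg x₂]
    have e1 : y₁ ^ 2 = r₁ ^ 2 * (1 - k₁ ^ 2) := by rw [ex₁] at es₁; linarith
    have e2 : y₂ ^ 2 = r₂ ^ 2 * (1 - k₂ ^ 2) := by rw [ex₂] at es₂; linarith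
    rw [e1, e2, ex₁, ex₂] at h4
    have h5 : (r₁ * r₂) ^ 2 * k₂ ^ 2 < (r₁ * r₂) ^ 2 * k₁ ^ 2 := by nlinarith
    have h6 := mul_le_mul_of_nonneg_left h3 (sq_nonneg (r₁ * r₂))
    linarith

lemma fg_quasi {x₁ y₁ x₂ y₂ x₃ y₃ : ℝ} (hy₁ : 0 < y₁) (hy₂ : 0 < y₂) (hy₃ : 0 < y₃)
    (h12 : x₁ < x₂) (h23 : x₂ < x₃) (hF12 : Fint x₁ y₁ = Fint x₂ y₂) (hF23 : Fint x₂ y₂ = Fint x₃ y₃) :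
    min (y₁ / (x₁ ^ 2 + y₁ ^ 2)) (y₃ / (x₃ ^ 2 + y₃ ^ 2)) < y₂ / (x₂ ^ 2 + y₂ ^ 2) := by
  obtain ⟨r₁, θ₁, hr₁, hθ₁, hθ₁', ex₁, ey₁, es₁⟩ := fg_point (x := x₁) hy₁
  obtain ⟨r₂, θ₂, hr₂, hθ₂, hθ₂', ex₂, ey₂, es₂⟩ := fg_point (x := x₂) hy₂
  obtain ⟨r₃, θ₃, hr₃, hθ₃, hθ₃', ex₃, ey₃, es₃⟩ := fg_point (x := x₃) hy₃
  have t12 := fg_angle hy₁ hy₂ hr₁ hr₂ hθ₁ hθ₁' hθ₂ hθ₂' ex₁ ex₂ es₁ es₂ hF12 h12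
  have t23 := fg_angle hy₂ hy₃ hr₂ hr₃ hθ₂ hθ₂' hθ₃ hθ₃' ex₂ ex₃ es₂ es₃ hF23 h23
  by_contra hcon
  have hcon := le_min_iff.1 (not_lt.1 hcon)
  have hs₁ := fg_sin_pos hθ₁ hθ₁'
  have hs₂ := fg_sin_pos hθ₂ hθ₂'
  have hs₃ := fg_sin_pos hθ₃ hθ₃'
  have hR : 0 < r₂ / Real.sin θ₂ := div_pos hr₂ hs₂
  have q := fgG_quasi hR hθ₃ t23 t12 hθ₁'
  have aux : ∀ {r s y y' r' s' : ℝ}, 0 < r → 0 < s → 0 < r' → 0 < s' → y = r * s → y' = r' * s' →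
      y' / r' ^ 2 ≤ y / r ^ 2 → r ≤ r' / s' * s := by
    intro r s y y' r' s' a b c d e f g
    have e1 : y / r ^ 2 = s / r := by rw [e]; field_simp
    have e2 : y' / r' ^ 2 = s' / r' := by rw [f]; field_simp
    rw [e1, e2, div_le_div_iff₀ c a] at g
    rw [div_mul_eq_mul_div, le_div_iff₀ d]; linarith
  rw [es₁, es₂, es₃] at hcon
  have c1 := aux hr₁ hs₁ hr₂ hs₂ ey₁ ey₂ hcon.1
  have c3 := aux hr₃ hs₃ hr₂ hs₂ ey₃ ey₂ hcon.2
  rw [div_mul_cancel₀ _ hs₂.ne'] at q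
  rw [fg_polar hr₁ ex₁ es₁, fg_polar hr₂ ex₂ es₂] at hF12
  rw [fg_polar hr₂ ex₂ es₂, fg_polar hr₃ ex₃ es₃] at hF23
  have aux2 : ∀ {r r' θ : ℝ}, 0 < r → r ≤ r' → 0 < θ → θ < Real.pi →
      fgJ r' (Real.cos θ) ≤ fgJ r (Real.cos θ) := by
    intro r r' θ a b c d
    rcases b.eq_or_lt with h | h
    · rw [h]
    · exact (fgJ_anti a h (fg_cos_gt c d) (fg_cos_lt c d)).le
  have d1 := aux2 hr₁ c1 hθ₁ hθ₁'
  have d3 := aux2 hr₃ c3 hθ₃ hθ₃'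
  rcases lt_max_iff.1 q with h | h <;> linarith

/-- the density `f_α` is unimodal: there is `ω_α ∈ (s_α, ∞)` with
`f_α` strictly increasing on `[s_α, ω_α]` and strictly decreasing on `[ω_α, ∞)`. -/
theorem free_gamma_density_unimodal
    (α : ℝ) (hα : 0 < α) (c : ℝ) (hc : 0 < c)
    (hceq : (∫ t in Set.Ioi (0:ℝ), t * Real.exp (-t) / (c + t)^2) = 1/α)
    (v : ℝ → ℝ) (hv0 : ∀ x ≤ -c, v x = 0)
    (hvpos : ∀ x, -c < x → 0 < v x)
    (hveq : ∀ x, -c < x → Fint x (v x) = 1/α)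
    (hvuniq : ∀ x, -c < x → ∀ y, 0 < y → Fint x y = 1/α → y = v x)
    (P : ℝ → ℝ)
    (hP : ∀ x : ℝ, ((P x : ℝ) : ℂ) = Hfun α ((x : ℂ) + (v x : ℝ) * Complex.I))
    (Pinv : ℝ → ℝ)
    (hPinv₁ : Function.LeftInverse Pinv P)
    (hPinv₂ : Function.RightInverse Pinv P)
    (s : ℝ) (hs : s = P (-c))
    (f : ℝ → ℝ) (hf0 : ∀ ξ ≤ s, f ξ = 0)
    (hf1 : ∀ ξ, s < ξ → f ξ =
      (1 / Real.pi) * (v (Pinv ξ) / ((Pinv ξ)^2 + (v (Pinv ξ))^2))) :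
    ∃ ω : ℝ, s < ω ∧
      StrictMonoOn f (Set.Icc s ω) ∧
      StrictAntiOn f (Set.Ici ω) := by
  have hFc : Fint (-c) 0 = 1 / α := by
    rw [← hceq, Fint]
    congr 1; ext t
    congr 1; ring
  have hval : ∀ x, x < 0 ∨ v x ≠ 0 := fun x => by
    rcases le_or_gt x (-c) with h | h
    · left; linarith
    · right; exact (hvpos x h).ne'
  have hleft : ∀ x y, x ≤ -c → 0 < y → Fint x y < 1 / α := fun x y hx hy => by
    rw [← hFc]
    refine fgF_lt (Or.inr hy.ne') (Or.inl (by linarith)) fun t ht => ?_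
    nlinarith [sq_pos_of_pos hy]
  have hFle : ∀ x, Fint x (v x) ≤ 1 / α := fun x => by
    rcases lt_trichotomy x (-c) with h | h | h
    · rw [hv0 x h.le, ← hFc]
      refine (fgF_lt (Or.inl (by linarith)) (Or.inl (by linarith)) fun t ht => ?_).le
      nlinarith
    · rw [hv0 x h.le, h, hFc]
    · exact (hveq x h).le
  have hmono : StrictMono P := fun a b hab =>
    lt_of_le_of_ne (fgH_diff hα (hval a) (hval b) (hFle a) (hFle b) hab (hP a) (hP b))
      fun h => hab.ne (hPinv₁.injective h)
  have hdist : ∀ x y, 0 < y → Fint x y = 1 / α → c ^ 2 ≤ x ^ 2 + y ^ 2 := fun x y hy hF => by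
    by_contra hlt
    have hlt := not_le.1 hlt
    have : Fint (-c) 0 < Fint x y := by
      refine fgF_lt (Or.inl (by linarith)) (Or.inr hy.ne') fun t ht => ?_
      have : -c < x := by nlinarith [sq_pos_of_pos hy]
      nlinarith
    linarith
  have hmax : ∃ x₀, -c < x₀ ∧ ∀ x, -c < x →
      v x / (x ^ 2 + v x ^ 2) ≤ v x₀ / (x₀ ^ 2 + v x₀ ^ 2) := by
    have hc0 : -c < 0 := by linarith
    have hv00 := hvpos 0 hc0
    set m := v 0 / (0 ^ 2 + v 0 ^ 2) with hm
    have hmpos : 0 < m := by positivity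
    have hmc : 0 < m * c ^ 2 := by positivity
    set A : Set (ℝ × ℝ) := Icc (-(1/m)) (1/m) ×ˢ Icc (m * c ^ 2) (1/m) with hA
    have hAc : IsCompact A := isCompact_Icc.prod isCompact_Icc
    have hcontF : ContinuousOn (fun p : ℝ × ℝ => Fint p.1 p.2) A :=
      (fgF_cont hmc).mono fun p hp => hp.2.1
    set K : Set (ℝ × ℝ) := A ∩ (fun p : ℝ × ℝ => Fint p.1 p.2) ⁻¹' {1 / α} with hK
    have hKcl : IsClosed K := hcontF.preimage_isClosed_of_isClosed hAc.isClosed isClosed_singleton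
    have hKc : IsCompact K := hAc.of_isClosed_subset hKcl inter_subset_left
    have hmem : ∀ x, -c < x → m ≤ v x / (x ^ 2 + v x ^ 2) → (x, v x) ∈ K := fun x hx hmx => by
      have hy := hvpos x hx
      have hd := hdist x (v x) hy (hveq x hx)
      have hr : 0 < x ^ 2 + v x ^ 2 := by positivity
      rw [le_div_iff₀ hr] at hmx
      have h1 : v x ≤ 1 / m := by
        rw [le_div_iff₀ hmpos]
        have : m * v x ^ 2 ≤ v x := by nlinarith [mul_nonneg hmpos.le (sq_nonneg x)]
        nlinarith
      have h2 : x ^ 2 ≤ (1 / m) ^ 2 := by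
        have : x ^ 2 ≤ v x / m := by
          rw [le_div_iff₀ hmpos]; nlinarith [mul_nonneg hmpos.le (sq_nonneg (v x))]
        have h3 : v x / m ≤ (1 / m) / m := by gcongr
        have : (1 / m) / m = (1 / m) ^ 2 := by field_simp
        linarith
      have h3 := abs_le_of_sq_le_sq' h2 (by positivity)
      refine ⟨⟨⟨h3.1, h3.2⟩, ?_, h1⟩, hveq x hx⟩
      exact (mul_le_mul_of_nonneg_left hd hmpos.le).trans hmx
    have hQcont : ContinuousOn (fun p : ℝ × ℝ => p.2 / (p.1 ^ 2 + p.2 ^ 2)) K := by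
      refine ContinuousOn.div (by fun_prop) (by fun_prop) fun p hp => ?_
      have : 0 < p.2 := hmc.trans_le hp.1.2.1
      positivity
    obtain ⟨p, hpK, hpmax⟩ := hKc.exists_isMaxOn ⟨_, hmem 0 hc0 le_rfl⟩ hQcont
    have hp2 : 0 < p.2 := hmc.trans_le hpK.1.2.1
    have hpF : Fint p.1 p.2 = 1 / α := hpK.2
    have hp1 : -c < p.1 := by
      by_contra h
      have := hleft p.1 p.2 (not_lt.1 h) hp2
      linarith
    have hpv := hvuniq p.1 hp1 p.2 hp2 hpF
    refine ⟨p.1, hp1, fun x hx => ?_⟩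
    rw [← hpv]
    rcases le_or_gt m (v x / (x ^ 2 + v x ^ 2)) with h | h
    · exact hpmax (hmem x hx h)
    · exact h.le.trans (hpmax (hmem 0 hc0 le_rfl))
  obtain ⟨x₀, hx₀, hx₀max⟩ := hmax
  have hPP : ∀ ξ, P (Pinv ξ) = ξ := hPinv₂
  have hgt : ∀ ξ, s < ξ → -c < Pinv ξ := fun ξ h => by
    rw [← hmono.lt_iff_lt, hPP, ← hs]; exact h
  have hpi := Real.pi_pos
  have hfpos : ∀ ξ, s < ξ → 0 < f ξ := fun ξ h => by
    have := hvpos _ (hgt ξ h)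
    rw [hf1 ξ h]; positivity
  have hω : s < P x₀ := by rw [hs]; exact hmono hx₀
  have hfmax : ∀ ξ, f ξ ≤ f (P x₀) := fun ξ => by
    rcases le_or_gt ξ s with h | h
    · rw [hf0 ξ h]; exact (hfpos _ hω).le
    · rw [hf1 ξ h, hf1 _ hω, hPinv₁ x₀]
      exact mul_le_mul_of_nonneg_left (hx₀max _ (hgt ξ h)) (by positivity)
  have hfq : ∀ a b d, s ≤ a → a < b → b < d → min (f a) (f d) < f b := fun a b d ha hab hbd => by
    rcases ha.eq_or_lt with h | h
    · exact (min_le_left _ _).trans_lt (by rw [hf0 a h.ge]; exact hfpos b (by linarith))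
    · have hb : s < b := by linarith
      have hd : s < d := by linarith
      have q := fg_quasi (hvpos _ (hgt a h)) (hvpos _ (hgt b hb)) (hvpos _ (hgt d hd))
        (by rw [← hmono.lt_iff_lt, hPP, hPP]; exact hab)
        (by rw [← hmono.lt_iff_lt, hPP, hPP]; exact hbd)
        ((hveq _ (hgt a h)).trans (hveq _ (hgt b hb)).symm)
        ((hveq _ (hgt b hb)).trans (hveq _ (hgt d hd)).symm)
      rw [hf1 a h, hf1 b hb, hf1 d hd, ← mul_min_of_nonneg _ _ (by positivity)]
      exact mul_lt_mul_of_pos_left q (by positivity)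
  have hstep : ∀ ξ, s ≤ ξ → ξ ≠ P x₀ → f ξ < f (P x₀) := fun ξ h hne => by
    refine lt_of_le_of_ne (hfmax ξ) fun heq => ?_
    rcases lt_or_gt_of_ne hne with hl | hl
    · have := hfq ξ ((ξ + P x₀) / 2) (P x₀) h (by linarith) (by linarith)
      rw [heq, min_self] at this
      exact absurd (hfmax _) (not_le.2 this)
    · have := hfq (P x₀) ((ξ + P x₀) / 2) ξ hω.le (by linarith) (by linarith)
      rw [heq, min_self] at this
      exact absurd (hfmax _) (not_le.2 this)
  refine ⟨P x₀, hω, ?_, ?_⟩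
  · intro a ha b hb hab
    rcases hb.2.eq_or_lt with h | h
    · rw [h]; exact hstep a ha.1 (by rw [← h]; exact hab.ne)
    · have := hfq a b (P x₀) ha.1 hab h
      rwa [min_eq_left (hfmax a)] at this
  · intro a ha b hb hab
    have ha : P x₀ ≤ a := ha
    rcases ha.eq_or_lt with h | h
    · rw [← h]; exact hstep b (by linarith) (by rw [h]; exact hab.ne')
    · have := hfq (P x₀) a b hω.le h hab
      rwa [min_eq_right (hfmax b)] at this
end
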